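/- arXiv:2009.11704 — 3 statements merged into one kernel-verified Lean document; each statement's English description precedes it below -/
import Mathlib

section
/- Let p ≥ 1 and q ≥ 2 be integers with p+q odd. Then the non-alternating linear Euler S̃-sum S̃_{p,q}^{1,1} lies in the subalgebra of ℝ generated over ℚ by the set {π} ∪ {ζ(2k+1) : k ≥ 1}. Moreover, for integers p ≥ 1 and q ≥ 1 with p+q odd, the alternating linear Euler S̃-sum S̃_{p,q}^{1,−1} lies in the subalgebra of ℝ generated over ℚ by the set {π, G} ∪ {ζ(2k+1) : k ≥ 1} ∪ {β(2k) : k ≥ 2}. -/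
open scoped BigOperators

/-- Alternating odd harmonic number `h_n^{(p)}(σ) = ∑_{k=1}^n σ^{k-1}/(k-1/2)^p`. -/
noncomputable def oddH (n p : ℕ) (σ : ℝ) : ℝ :=
  ∑ k ∈ Finset.range n, σ ^ k / ((k : ℝ) + 1 / 2) ^ p

/-- Linear Euler S̃-sum `S̃_{p,q}^{σ1,σ2} = ∑_{n≥1} σ2^{n-1} h_n^{(p)}(σ1)/n^q`. -/
noncomputable def SSum (p q : ℕ) (σ1 σ2 : ℝ) : ℝ :=
  ∑' n : ℕ, σ2 ^ n * oddH (n + 1) p σ1 / ((n : ℝ) + 1) ^ q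

/-- The Riemann zeta value `ζ(s) = ∑_{n≥1} 1/n^s`. -/
noncomputable def zetaVal (s : ℕ) : ℝ := ∑' n : ℕ, 1 / ((n : ℝ) + 1) ^ s

/-- The Dirichlet beta value `β(s) = ∑_{n≥1} (-1)^{n-1}/(2n-1)^s`. -/
noncomputable def betaVal (s : ℕ) : ℝ := ∑' n : ℕ, (-1 : ℝ) ^ n / (2 * (n : ℝ) + 1) ^ s

/-- symmetric limit over half-integers -/
def Lim (f : ℤ → ℝ) (l : ℝ) : Prop :=
  Filter.Tendsto (fun N : ℕ => ∑ k ∈ Finset.Ico (-(N:ℤ)) N, f k) Filter.atTop (nhds l)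

lemma sum_Ico_pair (f : ℤ → ℝ) (N : ℕ) :
    ∑ k ∈ Finset.Ico (-(N:ℤ)) N, f k = ∑ k ∈ Finset.range N, (f k + f (-(k:ℤ) - 1)) := by
  induction N with
  | zero => simp
  | succ N ih =>
    rw [Finset.sum_range_succ, ← ih]
    have h1 : Finset.Ico (-((N+1:ℕ):ℤ)) ((N+1:ℕ):ℤ)
        = insert (-(N:ℤ) - 1) (insert (N:ℤ) (Finset.Ico (-(N:ℤ)) N)) := by
      ext x; simp only [Finset.mem_Ico, Finset.mem_insert]; push_cast; omega
    rw [h1, Finset.sum_insert, Finset.sum_insert]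
    · ring
    · simp
    · simp only [Finset.mem_Ico, Finset.mem_insert]; omega

lemma Lim.sub {f g : ℤ → ℝ} {a b : ℝ} (hf : Lim f a) (hg : Lim g b) :
    Lim (fun k => f k - g k) (a - b) := by
  unfold Lim at *
  simpa [Finset.sum_sub_distrib] using Filter.Tendsto.sub hf hg

lemma Lim.const_mul {f : ℤ → ℝ} {a : ℝ} (c : ℝ) (hf : Lim f a) :
    Lim (fun k => c * f k) (c * a) := by
  unfold Lim at *
  simpa [Finset.mul_sum] using Filter.Tendsto.const_mul c hf

lemma Lim.single (k0 : ℤ) (c : ℝ) : Lim (fun k => if k = k0 then c else 0) c := by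
  unfold Lim
  refine tendsto_const_nhds.congr' ?_
  filter_upwards [Filter.eventually_gt_atTop k0.natAbs] with N hN
  rw [Finset.sum_ite_eq', if_pos]
  rw [Finset.mem_Ico]; omega

lemma HasSum.lim {f : ℤ → ℝ} {a : ℝ} (hf : HasSum f a) : Lim f a := by
  unfold Lim
  refine Filter.Tendsto.comp (f := fun N : ℕ => Finset.Ico (-(N:ℤ)) N) hf ?_
  rw [SummationFilter.unconditional_filter, Filter.tendsto_atTop]
  intro s
  filter_upwards [Filter.eventually_gt_atTop (∑ i ∈ s, i.natAbs)] with N hN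
  intro i hi
  have := Finset.single_le_sum (f := fun i : ℤ => i.natAbs) (fun _ _ => Nat.zero_le _) hi
  simp only [Finset.mem_Ico] at *
  omega

lemma sum_Ico_shift (f : ℤ → ℝ) (N m : ℕ) :
    ∑ k ∈ Finset.Ico (-(N:ℤ)) N, f (k + m) = ∑ k ∈ Finset.Ico (-(N:ℤ)) N, f k
      + ∑ j ∈ Finset.range m, (f (N + j) - f (-(N:ℤ) + j)) := by
  induction m with
  | zero => simp
  | succ m ih =>
    rw [Finset.sum_range_succ, ← add_assoc, ← ih]
    have e1 : ∑ k ∈ Finset.Ico (-(N:ℤ)) N, f (k + ((m+1:ℕ):ℤ))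
        = ∑ k ∈ Finset.Ico (-(N:ℤ)+1) (N+1), f (k + m) := by
      rw [← Finset.sum_Ico_add' (fun k : ℤ => f (k + m)) (-(N:ℤ)) N 1]
      refine Finset.sum_congr rfl fun k _ => ?_
      congr 1; push_cast; ring
    rw [e1]
    have e2 : insert (N:ℤ) (Finset.Ico (-(N:ℤ)) N) = Finset.Ico (-(N:ℤ)) (N+1) := by
      ext x; simp only [Finset.mem_Ico, Finset.mem_insert]; omega
    have e3 : insert (-(N:ℤ)) (Finset.Ico (-(N:ℤ)+1) (N+1)) = Finset.Ico (-(N:ℤ)) (N+1) := by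
      ext x; simp only [Finset.mem_Ico, Finset.mem_insert]; omega
    have e4 := congrArg (fun s => ∑ k ∈ s, f (k + m)) (e2.trans e3.symm)
    rw [Finset.sum_insert (by simp), Finset.sum_insert (by simp)] at e4
    linarith

lemma Lim.shift {f : ℤ → ℝ} {a : ℝ} (hf : Lim f a) (hz : ∀ k : ℤ, |f k| ≤ 1 / |(k:ℝ)|) (m : ℕ) :
    Lim (fun k => f (k + m)) a := by
  unfold Lim at *
  simp_rw [sum_Ico_shift]
  rw [show nhds a = nhds (a + ∑ j ∈ Finset.range m, ((0:ℝ) - 0)) by simp]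
  refine hf.add (tendsto_finsetSum _ fun j _ => Filter.Tendsto.sub ?_ ?_)
  · rw [tendsto_zero_iff_abs_tendsto_zero]
    refine squeeze_zero (fun _ => abs_nonneg _) (fun N => hz _) ?_
    refine Filter.Tendsto.const_div_atTop ?_ 1
    refine Filter.tendsto_abs_atTop_atTop.comp ?_
    push_cast
    exact Filter.tendsto_atTop_add_const_right _ _ tendsto_natCast_atTop_atTop
  · rw [tendsto_zero_iff_abs_tendsto_zero]
    refine squeeze_zero (fun _ => abs_nonneg _) (fun N => hz _) ?_
    refine Filter.Tendsto.const_div_atTop ?_ 1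
    refine Filter.tendsto_abs_atBot_atTop.comp ?_
    push_cast
    exact Filter.tendsto_atBot_add_const_right _ _
      (Filter.tendsto_neg_atTop_atBot.comp tendsto_natCast_atTop_atTop)

/-! constants -/

lemma eo (f : ℕ → ℝ) {a b : ℝ} (he : HasSum (fun n => f (2*n)) a)
    (ho : HasSum (fun n => f (2*n+1)) b) : HasSum f (a + b) := he.even_add_odd ho

lemma hasSum_cg {α : Type*} {f g : α → ℝ} {a : ℝ} (h : HasSum f a) (hg : ∀ n, g n = f n) : HasSum g a := by
  rwa [show g = f from funext hg]


lemma zeta_hasSum (s : ℕ) (hs : 2 ≤ s) : HasSum (fun n : ℕ => 1 / ((n:ℝ) + 1) ^ s) (zetaVal s) := by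
  have h : Summable (fun n : ℕ => 1 / ((n:ℝ)) ^ s) :=
    Real.summable_one_div_nat_pow.mpr (by omega)
  have h2 := (summable_nat_add_iff 1).mpr h
  have h3 : Summable (fun n : ℕ => 1 / ((n:ℝ) + 1) ^ s) := by simpa using h2
  exact h3.hasSum

lemma zeta_hasSum' (s : ℕ) (hs : 2 ≤ s) : HasSum (fun n : ℕ => 1 / (n:ℝ) ^ s) (zetaVal s) := by
  rw [← hasSum_nat_add_iff' 1]
  simpa [show s ≠ 0 by omega] using zeta_hasSum s hs

lemma lam_summable (s : ℕ) (hs : 2 ≤ s) : Summable (fun n : ℕ => 1 / ((n:ℝ) + 1/2) ^ s) := by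
  have h : Summable (fun n : ℕ => 1 / ((n:ℝ)) ^ s) :=
    Real.summable_one_div_nat_pow.mpr (by omega)
  have h2 := (h.comp_injective (i := fun n : ℕ => 2 * n + 1) (fun a b => by simp)).mul_left ((2:ℝ)^s)
  refine h2.congr fun n => ?_
  simp only [Function.comp]
  push_cast
  rw [show (2 * (n:ℝ) + 1) = 2 * (n + 1/2) by ring, mul_pow]
  field_simp

lemma lam_hasSum (s : ℕ) (hs : 2 ≤ s) :
    HasSum (fun n : ℕ => 1 / ((n:ℝ) + 1/2) ^ s) ((2^s - 1) * zetaVal s) := by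
  have h := zeta_hasSum' s hs
  have he : HasSum (fun n : ℕ => 1 / ((2 * n : ℕ):ℝ) ^ s) (zetaVal s / 2^s) := by
    refine hasSum_cg (h.div_const (2^s)) ?_
    intro n; push_cast; rw [mul_pow]; field_simp
  have ho : HasSum (fun n : ℕ => 1 / ((2 * n + 1 : ℕ):ℝ) ^ s)
      ((∑' n : ℕ, 1 / ((n:ℝ) + 1/2) ^ s) / 2^s) := by
    refine hasSum_cg ((lam_summable s hs).hasSum.div_const (2^s)) ?_
    intro n; push_cast
    rw [show (2 * (n:ℝ) + 1) = 2 * (n + 1/2) by ring, mul_pow]; field_simp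
  have h3 := (eo (fun n : ℕ => 1 / (n:ℝ) ^ s) he ho).unique h
  have h4 : (∑' n : ℕ, 1 / ((n:ℝ) + 1/2) ^ s) = (2^s - 1) * zetaVal s := by
    generalize (∑' n : ℕ, 1 / ((n:ℝ) + 1/2) ^ s) = t at h3 ⊢
    field_simp at h3; linarith
  rw [← h4]; exact (lam_summable s hs).hasSum

lemma eta_hasSum (s : ℕ) (hs : 2 ≤ s) :
    HasSum (fun n : ℕ => (-1:ℝ)^n / (n:ℝ) ^ s) (zetaVal s / 2^s - (2^s - 1) * zetaVal s / 2^s) := by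
  have h := zeta_hasSum' s hs
  have he : HasSum (fun n : ℕ => (-1:ℝ)^(2*n) / ((2 * n : ℕ):ℝ) ^ s) (zetaVal s / 2^s) := by
    refine hasSum_cg (h.div_const (2^s)) ?_
    intro n; push_cast; rw [mul_pow]; simp; field_simp
  have ho : HasSum (fun n : ℕ => (-1:ℝ)^(2*n+1) / ((2 * n + 1 : ℕ):ℝ) ^ s)
      (-((2^s - 1) * zetaVal s / 2^s)) := by
    refine hasSum_cg ((lam_hasSum s hs).div_const (2^s)).neg ?_
    intro n; push_cast
    rw [show (2 * (n:ℝ) + 1) = 2 * (n + 1/2) by ring, mul_pow]; simp [pow_succ]; field_simp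
  rw [sub_eq_add_neg]
  exact eo (fun n : ℕ => (-1:ℝ)^n / (n:ℝ) ^ s) he ho

lemma rat_mem (K : Subalgebra ℚ ℝ) (r : ℚ) : (r:ℝ) ∈ K := K.algebraMap_mem r

lemma two_pow_inv_mem (K : Subalgebra ℚ ℝ) (s : ℕ) : ((2:ℝ)^s)⁻¹ ∈ K := by
  have := rat_mem K ((2^s)⁻¹); push_cast at this; exact this

lemma zeta_even_mem (K : Subalgebra ℚ ℝ) (hpi : Real.pi ∈ K) (k : ℕ) (hk : k ≠ 0) :
    zetaVal (2*k) ∈ K := by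
  have h := (zeta_hasSum' (2*k) (by omega)).unique (hasSum_zeta_nat hk)
  rw [h]
  have : (-1 : ℝ) ^ (k + 1) * (2 : ℝ) ^ (2 * k - 1) * Real.pi ^ (2 * k) * (bernoulli (2 * k) : ℝ) / ((2 * k).factorial : ℝ)
    = (((-1)^(k+1) * 2^(2*k-1) * bernoulli (2*k) / ((2*k).factorial : ℚ) : ℚ) : ℝ) * Real.pi^(2*k) := by
    push_cast; ring
  rw [this]
  exact K.mul_mem (rat_mem K _) (K.pow_mem hpi _)

lemma betaodd (K : Subalgebra ℚ ℝ) (hpi : Real.pi ∈ K) (k : ℕ) :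
    ∃ A ∈ K, Filter.Tendsto (fun N : ℕ => ∑ n ∈ Finset.range N, (-1:ℝ)^n / ((n:ℝ)+1/2)^(2*k+1))
      Filter.atTop (nhds A) := by
  have key : ∀ n : ℕ, ∀ s, (-1:ℝ)^n / ((n:ℝ)+1/2)^s = 2^s * ((-1:ℝ)^n / (2*(n:ℝ)+1)^s) := by
    intro n s
    rw [show (2 * (n:ℝ) + 1) = 2 * (n + 1/2) by ring, mul_pow]; field_simp
  simp_rw [key, ← Finset.mul_sum]
  suffices h : ∃ A ∈ K, Filter.Tendsto (fun N : ℕ => ∑ n ∈ Finset.range N, (-1:ℝ)^n / (2*(n:ℝ)+1)^(2*k+1))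
      Filter.atTop (nhds A) by
    obtain ⟨A, hA, h⟩ := h
    refine ⟨2^(2*k+1) * A, K.mul_mem (K.pow_mem (by simpa using rat_mem K 2) _) hA, h.const_mul _⟩
  rcases Nat.eq_zero_or_pos k with rfl | hk
  · refine ⟨Real.pi/4, ?_, by simpa using Real.tendsto_sum_pi_div_four⟩
    have := K.mul_mem hpi (rat_mem K (1/4)); push_cast at this
    convert this using 1; ring
  · have h := hasSum_one_div_nat_pow_mul_sin (k := k) (by omega) (x := 1/4) (by constructor <;> norm_num)
    have he : HasSum (fun n : ℕ => 1 / ((2*n:ℕ):ℝ)^(2*k+1) * Real.sin (2 * Real.pi * (2*n:ℕ) * (1/4))) 0 := by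
      convert hasSum_zero with n
      rw [show 2 * Real.pi * ((2*n:ℕ):ℝ) * (1/4) = n * Real.pi by push_cast; ring, Real.sin_nat_mul_pi, mul_zero]
    have hs : ∀ n : ℕ, 1 / ((2*n+1:ℕ):ℝ)^(2*k+1) * Real.sin (2 * Real.pi * (2*n+1:ℕ) * (1/4))
        = (-1:ℝ)^n / (2*(n:ℝ)+1)^(2*k+1) := by
      intro n
      rw [show 2 * Real.pi * ((2*n+1:ℕ):ℝ) * (1/4) = Real.pi/2 + n * Real.pi by push_cast; ring,
        Real.sin_add_nat_mul_pi]
      simp; ring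
    have ho : Summable (fun n : ℕ => 1 / ((2*n+1:ℕ):ℝ)^(2*k+1) * Real.sin (2 * Real.pi * (2*n+1:ℕ) * (1/4))) :=
      by
      have hi : Function.Injective (fun n : ℕ => 2 * n + 1) := fun a b => by simp
      exact h.summable.comp_injective hi
    have h3 := (eo (fun n : ℕ => 1 / (n:ℝ)^(2*k+1) * Real.sin (2 * Real.pi * n * (1/4))) he ho.hasSum).unique h
    have h4 := ho.hasSum
    rw [zero_add] at h3
    rw [h3] at h4
    simp_rw [hs] at h4
    refine ⟨_, ?_, h4.tendsto_sum_nat⟩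
    rw [show (1/4:ℝ) = algebraMap ℚ ℝ (1/4) by simp, Polynomial.eval_map_algebraMap, Polynomial.aeval_algebraMap_apply]
    have := K.mul_mem (rat_mem K ((-1)^(k+1) * 2^(2*k+1) / 2 / ((2*k+1).factorial) * Polynomial.aeval (1/4) (Polynomial.bernoulli (2*k+1)))) (K.pow_mem hpi (2*k+1))
    convert this using 1
    push_cast
    rw [mul_pow]
    simp
    ring

lemma zeta_mem (K : Subalgebra ℚ ℝ) (hpi : Real.pi ∈ K)
    (hz : ∀ k : ℕ, 1 ≤ k → zetaVal (2*k+1) ∈ K) (s : ℕ) (hs : 2 ≤ s) : zetaVal s ∈ K := by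
  rcases Nat.even_or_odd' s with ⟨k, rfl | rfl⟩
  · exact zeta_even_mem K hpi k (by omega)
  · exact hz k (by omega)

lemma lam_mem (K : Subalgebra ℚ ℝ) (s : ℕ) (h : zetaVal s ∈ K) : (2^s - 1) * zetaVal s ∈ K :=
  K.mul_mem (by have := rat_mem K (2^s-1); push_cast at this; exact this) h

lemma eta_mem (K : Subalgebra ℚ ℝ) (hpi : Real.pi ∈ K) (ε : ℝ) (hε : ε = 1 ∨ ε = -1)
    (b : ℕ) (hb : Even b) (hb2 : 2 ≤ b) :
    ∃ A ∈ K, HasSum (fun n : ℕ => ε^n / (n:ℝ) ^ b) A := by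
  obtain ⟨k, rfl⟩ := hb
  have hk := zeta_even_mem K hpi k (by omega)
  rw [← two_mul] at *
  rcases hε with rfl | rfl
  · exact ⟨_, hk, by simpa using zeta_hasSum' (2*k) hb2⟩
  · refine ⟨_, ?_, eta_hasSum (2*k) hb2⟩
    simp only [div_eq_mul_inv]
    exact K.sub_mem (K.mul_mem hk (two_pow_inv_mem K _))
      (K.mul_mem (lam_mem K _ hk) (two_pow_inv_mem K _))

/-- admissible functions of `z = m + 1/2` -/
inductive Good (K : Subalgebra ℚ ℝ) (ε : ℝ) : ℕ → ℕ → (ℕ → ℝ) → Prop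
  | pos (w e : ℕ) (c : ℝ) (hc : c ∈ K) (k : ℕ) (hk : e ≤ k) (hp : Even (k + w)) :
      Good K ε w e (fun m => c / ((m:ℝ) + 1/2)^k)
  | alt (w e : ℕ) (hε : ε = -1) (c : ℝ) (hc : c ∈ K) (k : ℕ) (hk : e ≤ k) (hp : Odd (k + w)) :
      Good K ε w e (fun m => c * (-1)^m / ((m:ℝ) + 1/2)^k)
  | sub (w e : ℕ) (F G : ℕ → ℝ) (hF : Good K ε w e F) (hG : Good K ε w e G) :
      Good K ε w e (fun m => F m - G m)

lemma Good.div {K : Subalgebra ℚ ℝ} {ε : ℝ} {w e : ℕ} {F : ℕ → ℝ} (h : Good K ε w e F) :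
    Good K ε (w+1) (e+1) (fun m => F m / ((m:ℝ) + 1/2)) := by
  induction h with
  | pos c hc k hk hp =>
    have := Good.pos (K := K) (ε := ε) (w+1) (e+1) c hc (k+1) (by omega) (by grind)
    convert this using 2 with m
    rw [pow_succ, div_div]
  | alt hε c hc k hk hp =>
    have := Good.alt (K := K) (ε := ε) (w+1) (e+1) hε c hc (k+1) (by omega) (by grind)
    convert this using 2 with m
    rw [pow_succ, div_div]
  | sub F G hF hG h1 h2 =>
    have := Good.sub _ _ _ _ h1 h2
    convert this using 2 with m
    rw [sub_div]

lemma Good.mono {K : Subalgebra ℚ ℝ} {ε : ℝ} {w e : ℕ} {F : ℕ → ℝ} (h : Good K ε w e F)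
    {e' : ℕ} (he : e' ≤ e) : Good K ε w e' F := by
  induction h with
  | pos c hc k hk hp => exact .pos _ _ c hc k (by omega) hp
  | alt hε c hc k hk hp => exact .alt _ _ hε c hc k (by omega) hp
  | sub F G hF hG h1 h2 => exact .sub _ _ _ _ h1 h2

lemma Good.hasSum {K : Subalgebra ℚ ℝ} {ε : ℝ} (hpi : Real.pi ∈ K)
    (hz : ∀ k : ℕ, 1 ≤ k → zetaVal (2*k+1) ∈ K)
    (hb : ε = -1 → ∀ k : ℕ, 1 ≤ k → betaVal (2*k) ∈ K)
    {w e : ℕ} {F : ℕ → ℝ} (h : Good K ε w e F) (hw : Odd w) (he : 2 ≤ e) :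
    ∃ u ∈ K, HasSum F u := by
  induction h with
  | pos c hc k hk hp =>
    refine ⟨c * ((2^k-1) * zetaVal k), K.mul_mem hc (lam_mem K k (zeta_mem K hpi hz k (by omega))), ?_⟩
    refine hasSum_cg ((lam_hasSum k (by omega)).mul_left c) fun n => by ring
  | alt hε c hc k hk hp =>
    obtain ⟨j, rfl⟩ : ∃ j, k = 2 * j := by
      have : Even k := by grind
      obtain ⟨j, rfl⟩ := this; exact ⟨j, by ring⟩
    have key : ∀ n : ℕ, (-1:ℝ)^n / (2*(n:ℝ)+1)^(2*j) = (-1:ℝ)^n / ((n:ℝ)+1/2)^(2*j) / 2^(2*j) := by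
      intro n
      rw [show (2 * (n:ℝ) + 1) = 2 * (n + 1/2) by ring, mul_pow]; field_simp
    have hs : Summable (fun n : ℕ => (-1:ℝ)^n / (2*(n:ℝ)+1)^(2*j)) := by
      refine Summable.of_norm ?_
      refine ((lam_summable (2*j) (by omega)).div_const (2^(2*j))).congr fun n => ?_
      rw [key, norm_div, norm_div]
      simp [abs_of_nonneg (show (0:ℝ) ≤ n + 2⁻¹ by positivity)]
    have hs2 : HasSum (fun n : ℕ => (-1:ℝ)^n / (2*(n:ℝ)+1)^(2*j)) (betaVal (2*j)) := hs.hasSum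
    refine ⟨c * 2^(2*j) * betaVal (2*j), K.mul_mem (K.mul_mem hc (K.pow_mem (by simpa using rat_mem K 2) _))
      (hb hε j (by omega)), ?_⟩
    refine hasSum_cg (hs2.mul_left _) fun n => ?_
    rw [key]; field_simp
  | sub F G hF hG h1 h2 =>
    obtain ⟨u, hu, h1⟩ := h1
    obtain ⟨v, hv, h2⟩ := h2
    exact ⟨u - v, K.sub_mem hu hv, h1.sub h2⟩

/-- the summand -/
noncomputable def gg (ε : ℝ) (a b m : ℕ) (k : ℤ) : ℝ :=
  if k + m + 1 = 0 then 0 else ε ^ (k + m + 1) / (((k:ℝ) + 1/2)^a * ((k:ℝ) + m + 1)^b)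

lemma half_ne (k : ℤ) : (k:ℝ) + 1/2 ≠ 0 := by
  intro h
  have h2 : ((2 * k + 1 : ℤ) : ℝ) = 0 := by push_cast; linarith
  have : 2 * k + 1 = 0 := by exact_mod_cast h2
  omega

lemma gg_rec (ε : ℝ) (a b m : ℕ) (k : ℤ) :
    gg ε (a+1) (b+1) m k = 1 / ((m:ℝ)+1/2) * (gg ε (a+1) b m k - gg ε a (b+1) m k) := by
  unfold gg
  split_ifs with h
  · simp
  · have h1 := half_ne k
    have h2 : (k:ℝ) + m + 1 ≠ 0 := by exact_mod_cast h
    have h3 : (m:ℝ) + 1/2 ≠ 0 := by positivity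
    rw [pow_succ, pow_succ]
    generalize hx : (k:ℝ)+1/2 = x at *
    generalize hn : (k:ℝ)+m+1 = n at *
    have : (m:ℝ) + 1/2 = n - x := by rw [← hx, ← hn]; ring
    rw [this] at h3 ⊢
    field_simp

lemma eps_inv {ε : ℝ} (hε : ε = 1 ∨ ε = -1) (n : ℕ) : ε ^ (-(n:ℤ)) = ε ^ n := by
  rcases hε with rfl | rfl
  · simp
  · rw [zpow_neg, zpow_natCast]
    rcases Nat.even_or_odd n with h | h <;> simp [h]

lemma baseA (K : Subalgebra ℚ ℝ) (hpi : Real.pi ∈ K) (ε : ℝ) (hε : ε = 1 ∨ ε = -1) (a : ℕ) (ha : 1 ≤ a) :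
    ∃ A ∈ K, Lim (fun k => ε ^ k / ((k:ℝ)+1/2)^a) A ∧ (ε = 1 → Odd a → A = 0) ∧ (ε = -1 → Even a → A = 0) := by
  have key : ∀ k : ℕ, ε ^ (k:ℤ) / (((k:ℤ):ℝ)+1/2)^a + ε ^ (-(k:ℤ)-1) / (((-(k:ℤ)-1:ℤ):ℝ)+1/2)^a
      = (1 + (-1)^a * ε) * (ε^k / ((k:ℝ)+1/2)^a) := by
    intro k
    have := eps_inv hε (k+1)
    rw [show -(k:ℤ)-1 = -((k+1:ℕ):ℤ) by push_cast; ring, this]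
    rw [show (((-((k+1:ℕ):ℤ)):ℤ):ℝ) + 1/2 = (-1) * ((k:ℝ)+1/2) by push_cast; ring, mul_pow, zpow_natCast, pow_succ]
    have h1 : (-1:ℝ)^a ≠ 0 := by simp
    have h2 : ((-1:ℝ)^a) * (-1)^a = 1 := by rw [← mul_pow]; simp
    push_cast
    field_simp
    linear_combination (-(ε*ε^k)) * h2
  unfold Lim
  simp_rw [sum_Ico_pair, key, ← Finset.mul_sum]
  rcases hε with rfl | rfl
  · rcases Nat.even_or_odd a with h | h
    · have h2 : 2 ≤ a := by obtain ⟨j, rfl⟩ := h; omega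
      have hz : zetaVal a ∈ K := by
        obtain ⟨j, rfl⟩ := h
        rw [← two_mul]; exact zeta_even_mem K hpi j (by omega)
      refine ⟨2 * ((2^a-1) * zetaVal a), K.mul_mem (by simpa using rat_mem K 2) (lam_mem K a hz), ?_, ?_, ?_⟩
      · have := (lam_hasSum a h2).tendsto_sum_nat.const_mul 2
        convert this using 3
        · rw [h.neg_one_pow]; norm_num
        · simp
      · intro _ h'; exact absurd h (Nat.not_even_iff_odd.mpr h')
      · intro h'; norm_num at h'
    · refine ⟨0, K.zero_mem, ?_, by simp, by simp⟩
      simp [h.neg_one_pow]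
  · rcases Nat.even_or_odd a with h | h
    · refine ⟨0, K.zero_mem, ?_, by simp, by simp⟩
      simp [h.neg_one_pow]
    · obtain ⟨j, rfl⟩ := h
      obtain ⟨A, hA, hl⟩ := betaodd K hpi j
      refine ⟨2 * A, K.mul_mem (by simpa using rat_mem K 2) hA, ?_, ?_, ?_⟩
      · convert hl.const_mul 2 using 3
        have : Odd (2*j+1) := ⟨j, rfl⟩
        rw [this.neg_one_pow]; norm_num
      · intro h'; norm_num at h'
      · intro _ h'; exact absurd h' (by simp)

lemma baseB (K : Subalgebra ℚ ℝ) (hpi : Real.pi ∈ K) (ε : ℝ) (hε : ε = 1 ∨ ε = -1) (b : ℕ) (hb : 1 ≤ b) :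
    ∃ A ∈ K, Lim (fun n => if n = 0 then 0 else ε ^ n / (n:ℝ)^b) A ∧ (Odd b → A = 0) := by
  set ψ : ℤ → ℝ := fun n => if n = 0 then 0 else ε ^ n / (n:ℝ)^b with hψ
  have hb0 : b ≠ 0 := by omega
  have hp : ∀ k : ℕ, ψ k = ε^k / (k:ℝ)^b := by
    intro k
    simp only [hψ]
    split_ifs with h
    · have : k = 0 := by exact_mod_cast h
      subst this; simp [hb0]
    · simp
  have hn : ∀ k : ℕ, ψ (-(k:ℤ)-1) = (-1)^b * ψ ((k+1:ℕ):ℤ) := by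
    intro k
    rw [hp]
    simp only [hψ]
    rw [if_neg (by omega), show -(k:ℤ)-1 = -((k+1:ℕ):ℤ) by push_cast; ring, eps_inv hε]
    push_cast
    rw [show -((k:ℝ)+1) = (-1) * ((k:ℝ)+1) by ring, mul_pow]
    have h2 : ((-1:ℝ)^b) * (-1)^b = 1 := by rw [← mul_pow]; simp
    have h1 : (-1:ℝ)^b ≠ 0 := by simp
    field_simp
    linear_combination (-(ε*ε^k)) * h2
  have hsum : ∀ N : ℕ, ∑ k ∈ Finset.Ico (-(N:ℤ)) N, ψ k
      = (1 + (-1)^b) * ∑ k ∈ Finset.range N, ε^k / (k:ℝ)^b + (-1)^b * (ε^N / (N:ℝ)^b) := by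
    intro N
    rw [sum_Ico_pair, Finset.sum_add_distrib]
    simp_rw [hn, ← Finset.mul_sum, hp]
    have := Finset.sum_range_succ' (fun k : ℕ => ε^k / (k:ℝ)^b) N
    rw [Finset.sum_range_succ] at this
    simp only [Nat.cast_zero, zero_pow hb0, div_zero, add_zero] at this
    rw [← this]; ring
  have h0 : Filter.Tendsto (fun N : ℕ => (-1)^b * (ε^N / (N:ℝ)^b)) Filter.atTop (nhds 0) := by
    rw [tendsto_zero_iff_abs_tendsto_zero]
    have : Filter.Tendsto (fun N : ℕ => 1 / (N:ℝ)^b) Filter.atTop (nhds 0) :=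
      Filter.Tendsto.const_div_atTop ((Filter.tendsto_pow_atTop hb0).comp tendsto_natCast_atTop_atTop) 1
    refine this.congr fun N => ?_
    have he : |ε| = 1 := by rcases hε with rfl | rfl <;> simp
    simp [abs_mul, abs_div, abs_pow, he]
  unfold Lim
  simp_rw [hsum]
  rcases Nat.even_or_odd b with h | h
  · have h2 : 2 ≤ b := by obtain ⟨j, rfl⟩ := h; omega
    obtain ⟨A, hA, hl⟩ := eta_mem K hpi ε hε b h h2
    refine ⟨2 * A, K.mul_mem (by simpa using rat_mem K 2) hA, ?_, fun h' => absurd h (Nat.not_even_iff_odd.mpr h')⟩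
    have := (hl.tendsto_sum_nat.const_mul 2).add h0
    rw [add_zero] at this
    convert this using 3
    rw [h.neg_one_pow]; norm_num
  · refine ⟨0, K.zero_mem, ?_, by simp⟩
    convert h0 using 2
    rw [h.neg_one_pow]; ring

lemma inner (K : Subalgebra ℚ ℝ) (hpi : Real.pi ∈ K) (ε : ℝ) (hε : ε = 1 ∨ ε = -1) (a b : ℕ) (hab : 1 ≤ a + b) :
    ∃ F, Good K ε (a+b) (min a b) F ∧ ∀ m, Lim (gg ε a b m) (F m) := by
  have hε0 : ε ≠ 0 := by rcases hε with rfl | rfl <;> norm_num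
  induction a generalizing b with
  | zero =>
    obtain ⟨A, hA, hl, hA0⟩ := baseB K hpi ε hε b (by omega)
    refine ⟨fun m => A / ((m:ℝ)+1/2)^0, ?_, fun m => ?_⟩
    · rcases Nat.even_or_odd b with h | h
      · exact .pos _ _ A hA 0 (by simp) (by simpa using h)
      · rw [hA0 h]
        have := Good.pos (K := K) (ε := ε) (0+b) (min 0 b) 0 K.zero_mem b (by simp) (by grind)
        simpa using this
    · have h := hl.shift (by
        intro k
        split_ifs with h
        · simp [h]
        · have he : |ε^k| = 1 := by rcases hε with rfl | rfl <;> simp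
          rw [abs_div, he, abs_pow]
          have h1 : (1:ℝ) ≤ |(k:ℝ)| := by exact_mod_cast Int.one_le_abs h
          apply one_div_le_one_div_of_le (by linarith)
          exact le_self_pow₀ h1 (by omega)) (m+1)
      simp only [pow_zero, div_one]
      convert h using 2 with k
      unfold gg
      push_cast
      simp only [← add_assoc, pow_zero, one_mul]
  | succ a iha =>
    induction b with
    | zero =>
      obtain ⟨A, hA, hl, h1, h2⟩ := baseA K hpi ε hε (a+1) (by omega)
      refine ⟨fun m => ε^(m+1) * A - (-1)^(a+1) / ((m:ℝ)+1/2)^(a+1), ?_, fun m => ?_⟩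
      · refine .sub _ _ (fun m => ε^(m+1) * A) _ ?_ ?_
        · rcases Nat.even_or_odd (a+1) with h | h
          · rcases hε with rfl | rfl
            · have := Good.pos (K := K) (ε := 1) (a+1+0) (min (a+1) 0) A hA 0 (by simp) (by simpa using h)
              simpa using this
            · rw [h2 rfl h]
              have := Good.pos (K := K) (ε := -1) (a+1+0) (min (a+1) 0) 0 K.zero_mem 0 (by simp) (by simpa using h)
              simpa using this
          · rcases hε with rfl | rfl
            · rw [h1 rfl h]
              have := Good.pos (K := K) (ε := 1) (a+1+0) (min (a+1) 0) 0 K.zero_mem 1 (by simp) (by grind)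
              simpa using this
            · have := Good.alt (K := K) (ε := -1) (a+1+0) (min (a+1) 0) rfl (-A) (K.neg_mem hA) 0 (by simp) (by simpa using h)
              convert this using 2 with m
              rw [pow_succ]; simp; ring
        · refine .pos _ _ _ ?_ (a+1) (by simp) (by simp)
          have := rat_mem K ((-1)^(a+1)); push_cast at this; exact this
      · have hh := (hl.const_mul (ε^(m+1))).sub (Lim.single (-((m+1:ℕ):ℤ)) ((-1)^(a+1) / ((m:ℝ)+1/2)^(a+1)))
        convert hh using 2 with k
        unfold gg
        split_ifs with h h' h'
        · subst h'
          rw [eps_inv hε]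
          have : (((-((m+1:ℕ):ℤ)):ℤ):ℝ) + 1/2 = (-1) * ((m:ℝ)+1/2) := by push_cast; ring
          rw [this, mul_pow]
          have h3 : ε^(m+1) * ε^(m+1) = 1 := by
            rw [← mul_pow]; rcases hε with rfl | rfl <;> simp
          have h2 : ((-1:ℝ)^(a+1)) * (-1)^(a+1) = 1 := by rw [← mul_pow]; simp
          have h4 : (-1:ℝ)^(a+1) ≠ 0 := by simp
          field_simp
          push_cast at *
          linear_combination h2 - h3
        · push_cast at h'; omega
        · push_cast at h'; omega
        · rw [show k + m + 1 = k + ((m+1:ℕ):ℤ) by push_cast; ring, zpow_add₀ hε0, zpow_natCast]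
          simp; ring
    | succ b ihb =>
      obtain ⟨F, hF, hFl⟩ := ihb (by omega)
      obtain ⟨G, hG, hGl⟩ := iha (b+1) (by omega)
      refine ⟨fun m => (F m - G m) / ((m:ℝ)+1/2), ?_, fun m => ?_⟩
      · have e : a + (b+1) = a + 1 + b := by ring
        rw [e] at hG
        have h1 := hF.mono (e' := min a b) (by omega)
        have h2 := hG.mono (e' := min a b) (by omega)
        have := (Good.sub _ _ _ _ h1 h2).div
        rwa [show min (a+1) (b+1) = min a b + 1 by omega]
      · have := ((hFl m).sub (hGl m)).const_mul (1 / ((m:ℝ)+1/2))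
        convert this using 1
        · ext k; rw [gg_rec]
        · ring

lemma mainU (K : Subalgebra ℚ ℝ) (hpi : Real.pi ∈ K) (ε : ℝ) (hε : ε = 1 ∨ ε = -1)
    (hz : ∀ k : ℕ, 1 ≤ k → zetaVal (2*k+1) ∈ K)
    (hb : ε = -1 → ∀ k : ℕ, 1 ≤ k → betaVal (2*k) ∈ K) (a b c : ℕ) (hab : 1 ≤ a + b)
    (hodd : Odd (a + b + c)) (hc : 2 ≤ min a b + c) (u : ℝ)
    (hu : HasSum (fun p : ℕ × ℤ => gg ε a b p.1 p.2 / ((p.1:ℝ)+1/2)^c) u) : u ∈ K := by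
  obtain ⟨F, hF, hl⟩ := inner K hpi ε hε a b hab
  have hG : Good K ε (a+b+c) (min a b + c) (fun m => F m / ((m:ℝ)+1/2)^c) := by
    clear hodd hc hu
    induction c with
    | zero => simpa using hF
    | succ c ih =>
      have h := ih.div
      have e : (fun m : ℕ => F m / ((m:ℝ)+1/2)^(c+1))
          = fun m : ℕ => F m / ((m:ℝ)+1/2)^c / ((m:ℝ)+1/2) := by
        funext m
        rw [pow_succ, div_div]
      rw [e]; exact h
  obtain ⟨v, hv, hs⟩ := hG.hasSum hpi hz hb hodd hc
  have h1 := hu.prod_fiberwise (g := fun m => F m / ((m:ℝ)+1/2)^c) (by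
    intro m
    have hsm : Summable (fun k : ℤ => gg ε a b m k / ((m:ℝ)+1/2)^c) := hu.summable.prod_factor m
    have h2 := hsm.hasSum.lim
    have h3 := (hl m).const_mul (1 / ((m:ℝ)+1/2)^c)
    have h4 : (∑' k : ℤ, gg ε a b m k / ((m:ℝ)+1/2)^c) = F m / ((m:ℝ)+1/2)^c := by
      have h5 : Lim (fun k => gg ε a b m k / ((m:ℝ)+1/2)^c) (F m / ((m:ℝ)+1/2)^c) := by
        convert h3 using 1
        · funext k; ring
        · ring
      exact tendsto_nhds_unique h2 h5
    rw [← h4]; exact hsm.hasSum)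
  rw [h1.unique hs]; exact hv

lemma hasSum_ext {α : Type*} (e : ℕ × ℕ → α) (he : Function.Injective e) (f g : α → ℝ) {A : ℝ}
    (h : HasSum (fun p => f (e p)) A) (hg : ∀ p, g (e p) = f (e p))
    (h0 : ∀ x, g x ≠ 0 → ∃ p, e p = x) : HasSum g A := by
  refine (Function.Injective.hasSum_iff (f := g) he ?_).1 ?_
  · intro x hx
    by_contra hne
    exact hx (h0 x hne)
  · convert h using 1
    funext p; exact hg p

lemma region (f : ℕ × ℤ → ℝ) (h0 : ∀ m : ℕ, f (m, -(m:ℤ)-1) = 0) {A B C : ℝ}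
    (h1 : HasSum (fun p : ℕ × ℕ => f (p.2, (p.1:ℤ))) A)
    (h2 : HasSum (fun p : ℕ × ℕ => f (p.1 + p.2 + 1, -(p.1:ℤ)-1)) B)
    (h3 : HasSum (fun p : ℕ × ℕ => f (p.1, -((p.1:ℤ)+p.2+1)-1)) C) : HasSum f (A + B + C) := by
  have k1 : HasSum (fun x : ℕ × ℤ => if 0 ≤ x.2 then f x else 0) A := by
    refine hasSum_ext (fun p : ℕ × ℕ => (p.2, (p.1:ℤ))) ?_ f _ h1 ?_ ?_
    · rintro ⟨a, b⟩ ⟨c, d⟩ h; simp at h ⊢; omega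
    · rintro ⟨a, b⟩; simp
    · rintro ⟨m, k⟩ h
      simp only [ne_eq, ite_eq_right_iff, not_forall] at h
      obtain ⟨hk, -⟩ := h
      refine ⟨(k.toNat, m), ?_⟩
      simp only [Prod.mk.injEq, true_and]; omega
  have k2 : HasSum (fun x : ℕ × ℤ => if x.2 < 0 ∧ 0 < x.2 + x.1 + 1 then f x else 0) B := by
    refine hasSum_ext (fun p : ℕ × ℕ => (p.1 + p.2 + 1, -(p.1:ℤ)-1)) ?_ f _ h2 ?_ ?_
    · rintro ⟨a, b⟩ ⟨c, d⟩ h; simp at h ⊢; omega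
    · rintro ⟨a, b⟩; rw [if_pos]; simp only; push_cast; omega
    · rintro ⟨m, k⟩ h
      simp only [ne_eq, ite_eq_right_iff, not_forall] at h
      obtain ⟨hk, -⟩ := h
      refine ⟨((-k-1).toNat, (k+m).toNat), ?_⟩
      simp only [Prod.mk.injEq]; omega
  have k3 : HasSum (fun x : ℕ × ℤ => if x.2 + x.1 + 1 < 0 then f x else 0) C := by
    refine hasSum_ext (fun p : ℕ × ℕ => (p.1, -((p.1:ℤ)+p.2+1)-1)) ?_ f _ h3 ?_ ?_
    · rintro ⟨a, b⟩ ⟨c, d⟩ h; simp at h ⊢; omega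
    · rintro ⟨a, b⟩; rw [if_pos]; simp only; omega
    · rintro ⟨m, k⟩ h
      simp only [ne_eq, ite_eq_right_iff, not_forall] at h
      obtain ⟨hk, -⟩ := h
      refine ⟨(m, (-k-m-2).toNat), ?_⟩
      simp only [Prod.mk.injEq, true_and]; omega
  convert (k1.add k2).add k3 using 1
  funext ⟨m, k⟩
  simp only
  by_cases e : k = -(m:ℤ) - 1
  · subst e; rw [h0, if_neg (by omega), if_neg (by omega), if_neg (by omega)]; simp
  · by_cases a : 0 ≤ k
    · rw [if_pos a, if_neg (by omega), if_neg (by omega)]; simp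
    · by_cases b : 0 < k + m + 1
      · rw [if_neg a, if_pos (by omega), if_neg (by omega)]; simp
      · rw [if_neg a, if_neg (by omega), if_pos (by omega)]; simp

lemma region2 (f : ℕ × ℕ → ℝ) {A B : ℝ}
    (h1 : HasSum (fun p : ℕ × ℕ => f (p.1, p.1 + p.2)) A)
    (h2 : HasSum (fun p : ℕ × ℕ => f (p.1 + p.2 + 1, p.2)) B) : HasSum f (A + B) := by
  have k1 : HasSum (fun x : ℕ × ℕ => if x.1 ≤ x.2 then f x else 0) A := by
    refine hasSum_ext (fun p : ℕ × ℕ => (p.1, p.1 + p.2)) ?_ f _ h1 ?_ ?_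
    · rintro ⟨a, b⟩ ⟨c, d⟩ h; simp at h ⊢; omega
    · rintro ⟨a, b⟩; simp
    · rintro ⟨m, k⟩ h
      simp only [ne_eq, ite_eq_right_iff, not_forall] at h
      obtain ⟨hk, -⟩ := h
      refine ⟨(m, k - m), ?_⟩
      simp only [Prod.mk.injEq, true_and]; omega
  have k2 : HasSum (fun x : ℕ × ℕ => if x.2 < x.1 then f x else 0) B := by
    refine hasSum_ext (fun p : ℕ × ℕ => (p.1 + p.2 + 1, p.2)) ?_ f _ h2 ?_ ?_
    · rintro ⟨a, b⟩ ⟨c, d⟩ h; simp at h ⊢; omega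
    · rintro ⟨a, b⟩; rw [if_pos]; simp only; omega
    · rintro ⟨m, k⟩ h
      simp only [ne_eq, ite_eq_right_iff, not_forall] at h
      obtain ⟨hk, -⟩ := h
      refine ⟨(m - k - 1, k), Prod.ext ?_ rfl⟩
      simp only at hk ⊢; omega
  convert k1.add k2 using 1
  funext ⟨m, k⟩
  simp only
  by_cases a : m ≤ k
  · rw [if_pos a, if_neg (by omega)]; simp
  · rw [if_neg a, if_pos (by exact Nat.lt_of_not_le a)]; simp

lemma antidiag (f : ℕ × ℕ → ℝ) {A : ℝ} (h : HasSum f A) :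
    HasSum (fun n => ∑ k ∈ Finset.range (n+1), f (k, n - k)) A := by
  have h1 := ((Equiv.hasSum_iff Finset.HasAntidiagonal.sigmaAntidiagonalEquivProd).mpr h).sigma (fun n => hasSum_fintype _)
  refine hasSum_cg h1 fun n => ?_
  rw [← Finset.Nat.sum_antidiagonal_eq_sum_range_succ_mk]
  rw [← Finset.sum_coe_sort]
  rfl

lemma eps_abs {ε : ℝ} (hε : ε = 1 ∨ ε = -1) : |ε| = 1 := by rcases hε with rfl | rfl <;> simp

lemma eps_mem {ε : ℝ} (hε : ε = 1 ∨ ε = -1) (K : Subalgebra ℚ ℝ) : ε ∈ K := by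
  rcases hε with rfl | rfl
  · exact K.one_mem
  · exact K.neg_mem K.one_mem

lemma prodSum (f g : ℕ → ℝ) {a b : ℝ} (hf : HasSum f a) (hg : HasSum g b) :
    HasSum (fun x : ℕ × ℕ => f x.1 * g x.2) (a * b) :=
  HasSum.mul hf hg (summable_mul_of_summable_norm hf.summable.norm hg.summable.norm)

lemma caseA (K : Subalgebra ℚ ℝ) (hpi : Real.pi ∈ K) (ε : ℝ) (hε : ε = 1 ∨ ε = -1)
    (hz : ∀ k : ℕ, 1 ≤ k → zetaVal (2*k+1) ∈ K)
    (hb : ε = -1 → ∀ k : ℕ, 1 ≤ k → betaVal (2*k) ∈ K) (p q : ℕ) (hp : 2 ≤ p) (hq : 2 ≤ q)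
    (hodd : Odd (p + q)) : SSum p q 1 ε ∈ K := by
  have hεε : ε * ε = 1 := by rcases hε with rfl | rfl <;> simp
  obtain ⟨L, hL, hlam⟩ : ∃ L ∈ K, HasSum (fun n : ℕ => 1 / ((n:ℝ) + 1/2) ^ p) L :=
    ⟨_, lam_mem K p (zeta_mem K hpi hz p hp), lam_hasSum p hp⟩
  obtain ⟨E, hetas⟩ : Summable (fun n : ℕ => ε^(n+1) / ((n:ℝ)+1)^q) := by
    refine Summable.of_norm ((zeta_hasSum q hq).summable.congr fun n => ?_)
    simp [eps_abs hε, abs_of_nonneg (show (0:ℝ) ≤ n + 1 by positivity)]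
  obtain ⟨T, hT⟩ : ∃ T : ℕ × ℕ → ℝ, T = fun x : ℕ × ℕ => 1 / ((x.1:ℝ)+1/2)^p * (ε^(x.2+1) / ((x.2:ℝ)+1)^q) := ⟨_, rfl⟩
  have hTL : HasSum T (L * E) := by
    rw [hT]; exact prodSum (fun n : ℕ => 1 / ((n:ℝ)+1/2)^p) (fun n : ℕ => ε^(n+1) / ((n:ℝ)+1)^q) hlam hetas
  have hTs : Summable T := hTL.summable
  have i1 : Function.Injective (fun p : ℕ × ℕ => (p.1, p.1 + p.2)) := by
    rintro ⟨a, b⟩ ⟨c, d⟩ h; simp at h ⊢; omega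
  have i2 : Function.Injective (fun p : ℕ × ℕ => (p.1 + p.2 + 1, p.2)) := by
    rintro ⟨a, b⟩ ⟨c, d⟩ h; simp at h ⊢; omega
  obtain ⟨I, hI⟩ : Summable (fun x : ℕ × ℕ => T (x.1, x.1 + x.2)) := hTs.comp_injective i1
  obtain ⟨J, hJ⟩ : Summable (fun x : ℕ × ℕ => T (x.1 + x.2 + 1, x.2)) := hTs.comp_injective i2
  have hIJ : I + J = L * E := (region2 T hI hJ).unique hTL
  have hU : HasSum (fun x : ℕ × ℤ => gg ε p q x.1 x.2 / ((x.1:ℝ)+1/2)^0)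
      (I + (-1)^p * (L * E) + (-1) * J) := by
    refine region _ ?_ ?_ ?_ ?_
    · intro m; simp only [gg]; rw [if_pos (by ring), zero_div]
    · refine hasSum_cg hI ?_
      rintro ⟨k, m⟩
      simp only [gg, hT, Function.comp]
      rw [if_neg (by omega), show (k:ℤ) + m + 1 = ((k+m+1:ℕ):ℤ) by push_cast; ring, zpow_natCast]
      push_cast
      field_simp
    · refine hasSum_cg (hTL.mul_left ((-1)^p)) ?_
      rintro ⟨j, i⟩
      simp only [gg, hT]
      push_cast
      rw [if_neg (by omega), show -(j:ℤ) - 1 + (j + i + 1) + 1 = ((i+1:ℕ):ℤ) by push_cast; ring, zpow_natCast]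
      rw [show -(j:ℝ) - 1 + 1/2 = (-1) * (j + 1/2) by ring, mul_pow,
        show -(j:ℝ) - 1 + (j + i + 1) + 1 = i + 1 by ring]
      have h2 : ((-1:ℝ)^p) * (-1)^p = 1 := by rw [← mul_pow]; simp
      have h4 : (-1:ℝ)^p ≠ 0 := by simp
      field_simp
      linear_combination (-(ε*ε^i)) * h2
    · refine hasSum_cg (hJ.mul_left (-1)) ?_
      rintro ⟨m, i⟩
      simp only [gg, hT, Function.comp]
      push_cast
      rw [if_neg (by omega), show -((m:ℤ) + i + 1) - 1 + m + 1 = -((i+1:ℕ):ℤ) by push_cast; ring, eps_inv hε]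
      rw [show -((m:ℝ) + i + 1) - 1 + 1/2 = (-1) * (m + i + 1 + 1/2) by ring, mul_pow,
        show -((m:ℝ) + i + 1) - 1 + m + 1 = (-1) * (i + 1) by ring, mul_pow]
      have h2 : ((-1:ℝ)^p) * (-1)^q = -1 := by rw [← pow_add]; exact hodd.neg_one_pow
      rw [show (-1:ℝ) ^ p * ((m:ℝ) + i + 1 + 1 / 2) ^ p * ((-1) ^ q * ((i:ℝ) + 1) ^ q)
        = - (((m:ℝ) + i + 1 + 1 / 2) ^ p * ((i:ℝ) + 1) ^ q) by linear_combination (((m:ℝ) + i + 1 + 1 / 2) ^ p * ((i:ℝ) + 1) ^ q) * h2]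
      rw [div_neg]
      field_simp
  have hUK := mainU K hpi ε hε hz hb p q 0 (by omega) (by simpa using hodd) (by omega) _ hU
  have hIK : I ∈ K := by
    have h2 : I = ((1/2 : ℚ) : ℝ) * ((I + (-1)^p * (L * E) + (-1) * J) + (1 - (-1)^p) * (L * E)) := by
      rw [← hIJ]; push_cast; ring
    rw [h2]
    refine K.mul_mem (rat_mem K _) (K.add_mem hUK ?_)
    rcases Nat.even_or_odd p with h | h
    · rw [h.neg_one_pow]; simp
    · have hqe : Even q := by grind
      obtain ⟨A, hA, hs⟩ := eta_mem K hpi ε hε q hqe hq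
      have hs' := (hasSum_nat_add_iff' 1).mpr hs
      have : E = A := by
        refine hetas.unique ?_
        simpa [show q ≠ 0 by omega] using hs'
      rw [this]
      refine K.mul_mem ?_ (K.mul_mem hL hA)
      have := rat_mem K (1 - (-1)^p); push_cast at this; exact this
  have hS : SSum p q 1 ε = ε * I := by
    refine HasSum.tsum_eq (hasSum_cg ((antidiag _ hI).mul_left ε) fun n => ?_)
    unfold oddH
    rw [Finset.mul_sum, Finset.mul_sum, Finset.sum_div]
    refine Finset.sum_congr rfl fun k hk => ?_
    have : k ≤ n := by simpa [Nat.lt_succ_iff] using hk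
    simp only [hT, Function.comp, Nat.add_sub_cancel' this, one_pow]
    rw [pow_succ]
    field_simp
    linear_combination (-ε^n) * hεε
  rw [hS]
  exact K.mul_mem (eps_mem hε K) hIK

lemma W_summable : Summable (fun x : ℕ × ℕ =>
    1 / (((x.1:ℝ)+1/2) * ((x.2:ℝ)+1/2) * ((x.1:ℝ)+x.2+1))) := by
  have h : Summable (fun n : ℕ => 1 / |(n:ℝ)+1/2| ^ (3/2:ℝ)) :=
    (Real.summable_one_div_nat_add_rpow (1/2) (3/2)).mpr (by norm_num)
  have h2 : Summable (fun n : ℕ => 1 / (((n:ℝ)+1/2) * √((n:ℝ)+1/2))) := by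
    refine h.congr fun n => ?_
    have hn : (0:ℝ) < n + 1/2 := by positivity
    rw [abs_of_pos hn, show (3/2:ℝ) = 1 + 1/2 by norm_num, Real.rpow_add hn, Real.rpow_one, Real.sqrt_eq_rpow]
  have h3 := h2.mul_of_nonneg h2 (fun n => by positivity) (fun n => by positivity)
  refine Summable.of_nonneg_of_le (fun x => by positivity) (fun x => ?_) h3
  rw [div_mul_div_comm, one_mul]
  have hu : (0:ℝ) < (x.1:ℝ) + 1/2 := by positivity
  have hv : (0:ℝ) < (x.2:ℝ) + 1/2 := by positivity
  rw [show (x.1:ℝ)+x.2+1 = (x.1+1/2) + (x.2+1/2) by ring]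
  generalize (x.1:ℝ) + 1/2 = u at *
  generalize (x.2:ℝ) + 1/2 = v at *
  refine one_div_le_one_div_of_le (by positivity) ?_
  have e1 := Real.sq_sqrt hu.le
  have e2 := Real.sq_sqrt hv.le
  have : √u * √v ≤ u + v := by nlinarith [sq_nonneg (√u - √v), mul_nonneg (Real.sqrt_nonneg u) (Real.sqrt_nonneg v)]
  calc u * √u * (v * √v) = u * v * (√u * √v) := by ring
    _ ≤ _ := by gcongr

lemma caseB (K : Subalgebra ℚ ℝ) (hpi : Real.pi ∈ K) (ε : ℝ) (hε : ε = 1 ∨ ε = -1)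
    (hz : ∀ k : ℕ, 1 ≤ k → zetaVal (2*k+1) ∈ K)
    (hb : ε = -1 → ∀ k : ℕ, 1 ≤ k → betaVal (2*k) ∈ K) (r : ℕ) (hr : Odd r) :
    SSum 1 (r+1) 1 ε ∈ K := by
  have hεε : ε * ε = 1 := by rcases hε with rfl | rfl <;> simp
  have hr1 : r ≠ 0 := by rintro rfl; simp at hr
  obtain ⟨I, hI⟩ : Summable (fun x : ℕ × ℕ =>
      ε^(x.1+x.2+1) / (((x.1:ℝ)+1/2) * ((x.2:ℝ)+1/2) * ((x.1:ℝ)+x.2+1)^r)) := by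
    refine Summable.of_norm_bounded W_summable fun x => ?_
    rw [norm_div, norm_pow, Real.norm_eq_abs, eps_abs hε, one_pow, Real.norm_of_nonneg (by positivity)]
    have : (x.1:ℝ)+x.2+1 ≤ ((x.1:ℝ)+x.2+1)^r :=
      le_self_pow₀ (by have : (0:ℝ) ≤ (x.1:ℝ) + x.2 := by positivity
                       linarith) hr1
    gcongr
  obtain ⟨V, hV⟩ : Summable (fun x : ℕ × ℕ =>
      ε^(x.2+1) / (((x.1:ℝ)+1/2) * ((x.2:ℝ)+1)^r * ((x.1:ℝ)+x.2+1+1/2))) := by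
    refine Summable.of_norm_bounded W_summable fun x => ?_
    rw [norm_div, norm_pow, Real.norm_eq_abs, eps_abs hε, one_pow, Real.norm_of_nonneg (by positivity)]
    have : (x.2:ℝ)+1/2 ≤ ((x.2:ℝ)+1)^r :=
      le_trans (by linarith) (le_self_pow₀ (by have : (0:ℝ) ≤ (x.2:ℝ) := by positivity
                                               linarith) hr1)
    have h3 : (x.1:ℝ)+x.2+1 ≤ (x.1:ℝ)+x.2+1+1/2 := by linarith
    exact one_div_le_one_div_of_le (by positivity)
      (mul_le_mul (mul_le_mul_of_nonneg_left this (by positivity)) h3 (by positivity) (by positivity))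
  have hU : HasSum (fun x : ℕ × ℤ => gg ε 1 r x.1 x.2 / ((x.1:ℝ)+1/2)^1) (I + (-1) * V + V) := by
    refine region _ ?_ ?_ ?_ ?_
    · intro m; simp only [gg]; rw [if_pos (by ring), zero_div]
    · refine hasSum_cg hI ?_
      rintro ⟨k, m⟩
      simp only [gg]
      rw [if_neg (by omega), show (k:ℤ) + m + 1 = ((k+m+1:ℕ):ℤ) by push_cast; ring, zpow_natCast]
      push_cast
      field_simp
    · refine hasSum_cg (hV.mul_left (-1)) ?_
      rintro ⟨j, i⟩
      simp only [gg]
      push_cast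
      rw [if_neg (by omega), show -(j:ℤ) - 1 + (j + i + 1) + 1 = ((i+1:ℕ):ℤ) by push_cast; ring, zpow_natCast]
      rw [show -(j:ℝ) - 1 + 1/2 = -(j + 1/2) by ring,
        show -(j:ℝ) - 1 + (j + i + 1) + 1 = i + 1 by ring, pow_one, pow_one, neg_mul, div_neg, neg_div, div_div, neg_one_mul]
    · refine hasSum_cg hV ?_
      rintro ⟨m, i⟩
      simp only [gg]
      push_cast
      rw [if_neg (by omega), show -((m:ℤ) + i + 1) - 1 + m + 1 = -((i+1:ℕ):ℤ) by push_cast; ring, eps_inv hε]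
      rw [show -((m:ℝ) + i + 1) - 1 + 1/2 = -(m + i + 1 + 1/2) by ring,
        show -((m:ℝ) + i + 1) - 1 + m + 1 = -(i + 1) by ring, hr.neg_pow, pow_one, pow_one, neg_mul_neg, div_div]
      congr 1
      ring
  have hUK := mainU K hpi ε hε hz hb 1 r 1 (by omega) (by grind) (by omega) _ hU
  have hS : SSum 1 (r+1) 1 ε = ε * (((1/2:ℚ):ℝ) * (I + (-1) * V + V)) := by
    rw [show I + (-1) * V + V = I by ring]
    refine HasSum.tsum_eq (hasSum_cg (((antidiag _ hI).mul_left ((1/2:ℚ):ℝ)).mul_left ε) fun n => ?_)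
    unfold oddH
    have e : ∀ k ∈ Finset.range (n+1), ε ^ (k + (n-k) + 1) / (((k:ℝ)+1/2) * (((n-k:ℕ):ℝ)+1/2) * ((k:ℝ)+((n-k:ℕ):ℝ)+1)^r)
        = ε^(n+1) / ((n:ℝ)+1)^(r+1) * (1 ^ k / ((k:ℝ)+1/2)^1 + 1 ^ (n+1-1-k) / (((n+1-1-k:ℕ):ℝ)+1/2)^1) := by
      intro k hk
      have hk : k ≤ n := by simpa [Nat.lt_succ_iff] using hk
      simp only [Nat.add_sub_cancel, one_pow, pow_one, Nat.add_sub_cancel' hk]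
      have h1 : (k:ℝ) + ((n-k:ℕ):ℝ) = n := by rw [← Nat.cast_add, Nat.add_sub_cancel' hk]
      rw [h1]
      have h2 : (n:ℝ) + 1 = ((k:ℝ)+1/2) + (((n-k:ℕ):ℝ)+1/2) := by rw [← h1]; ring
      have hu : (0:ℝ) < (k:ℝ) + 1/2 := by positivity
      have hv : (0:ℝ) < ((n-k:ℕ):ℝ) + 1/2 := by positivity
      have hn : (0:ℝ) < (n:ℝ) + 1 := by positivity
      generalize (k:ℝ) + 1/2 = u at *
      generalize ((n-k:ℕ):ℝ) + 1/2 = v at *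
      generalize (n:ℝ) + 1 = w at *
      rw [pow_succ w]
      field_simp
      rw [h2]; ring
    rw [Finset.sum_congr rfl e, ← Finset.mul_sum, Finset.sum_add_distrib,
      Finset.sum_range_reflect (fun k : ℕ => (1:ℝ) ^ k / ((k:ℝ)+1/2)^1) (n+1)]
    generalize ∑ k ∈ Finset.range (n+1), (1:ℝ) ^ k / ((k:ℝ)+1/2)^1 = t
    rw [pow_succ ε]
    push_cast
    field_simp
    linear_combination (-2 * t * ε^n) * hεε
  rw [hS]
  exact K.mul_mem (eps_mem hε K) (K.mul_mem (rat_mem K _) hUK)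

lemma caseC (p : ℕ) : SSum p 1 1 (-1) = 0 := by
  refine tsum_eq_zero_of_not_summable fun h => ?_
  have h1 : Summable (fun n : ℕ => 1 / ((n:ℝ)+1)) := by
    refine Summable.of_nonneg_of_le (fun n => by positivity) (fun n => ?_) h.norm
    rw [norm_div, norm_mul, norm_pow, norm_neg, norm_one, one_pow, one_mul, pow_one,
      Real.norm_of_nonneg (show (0:ℝ) ≤ n + 1 by positivity)]
    gcongr
    refine le_trans ?_ (le_abs_self _)
    unfold oddH
    have := Finset.single_le_sum (f := fun k : ℕ => (1:ℝ)^k / ((k:ℝ)+1/2)^p)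
      (fun _ _ => by positivity) (Finset.mem_range.mpr (Nat.succ_pos n))
    refine le_trans ?_ this
    simp only [pow_zero, Nat.cast_zero, zero_add]
    rw [le_div_iff₀ (by positivity), one_mul]
    exact pow_le_one₀ (by norm_num) (by norm_num)
  have h2 : Summable (fun n : ℕ => 1 / ((n:ℝ))) := by
    rw [← summable_nat_add_iff 1]; simpa using h1
  exact Real.not_summable_one_div_natCast h2

lemma allcases (K : Subalgebra ℚ ℝ) (hpi : Real.pi ∈ K) (ε : ℝ) (hε : ε = 1 ∨ ε = -1)
    (hz : ∀ k : ℕ, 1 ≤ k → zetaVal (2*k+1) ∈ K)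
    (hb : ε = -1 → ∀ k : ℕ, 1 ≤ k → betaVal (2*k) ∈ K) (p q : ℕ) (hp : 1 ≤ p) (hq : 2 ≤ q)
    (hodd : Odd (p + q)) : SSum p q 1 ε ∈ K := by
  by_cases h : p = 1
  · subst h
    obtain ⟨r, rfl⟩ : ∃ r, q = r + 1 := ⟨q - 1, by omega⟩
    exact caseB K hpi ε hε hz hb r (by grind)
  · exact caseA K hpi ε hε hz hb p q (by omega) hq hodd

theorem stmt4 :
    (∀ p q : ℕ, 1 ≤ p → 2 ≤ q → Odd (p + q) →
      SSum p q 1 1 ∈ Algebra.adjoin ℚ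
        ({Real.pi} ∪ {x : ℝ | ∃ k : ℕ, 1 ≤ k ∧ x = zetaVal (2 * k + 1)})) ∧
    (∀ p q : ℕ, 1 ≤ p → 1 ≤ q → Odd (p + q) →
      SSum p q 1 (-1) ∈ Algebra.adjoin ℚ
        ({Real.pi, betaVal 2}
          ∪ {x : ℝ | ∃ k : ℕ, 1 ≤ k ∧ x = zetaVal (2 * k + 1)}
          ∪ {x : ℝ | ∃ k : ℕ, 2 ≤ k ∧ x = betaVal (2 * k)})) := by
  constructor
  · intro p q hp hq h
    refine allcases _ (Algebra.subset_adjoin (by simp)) 1 (Or.inl rfl) ?_ (by norm_num) p q hp hq h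
    intro k hk
    exact Algebra.subset_adjoin (Or.inr ⟨k, hk, rfl⟩)
  · intro p q hp hq h
    by_cases h1 : q = 1
    · subst h1
      rw [caseC]; exact Subalgebra.zero_mem _
    · refine allcases _ (Algebra.subset_adjoin (by simp)) (-1) (Or.inr rfl) ?_ ?_ p q hp (by omega) h
      · intro k hk
        exact Algebra.subset_adjoin (Or.inl (Or.inr ⟨k, hk, rfl⟩))
      · intro _ k hk
        by_cases hk1 : k = 1
        · subst hk1; exact Algebra.subset_adjoin (by simp)
        · exact Algebra.subset_adjoin (Or.inr ⟨k, by omega, rfl⟩)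
end

section
/- Let p, q ≥ 1 be integers and σ1, σ2 ∈ {1,−1} with (p,σ1) ≠ (1,1). If (−1)^{p+q} = −σ2 (equivalently, the weight p+q and the quantity (1+σ2)/2 have the same parity), then the Kaneko–Tsumura double T-value T(p,q;σ1,σ2) lies in the subalgebra of ℝ generated over ℚ by the set {π, G} ∪ {ζ(2k+1) : k ≥ 1} ∪ {β(2k) : k ≥ 2}. -/
open scoped BigOperators

/-- Kaneko–Tsumura double T-value
`T(s1,s2;σ1,σ2) = 4 ∑_{n>k≥1} σ1^n σ2^k /((2n-2)^{s1} (2k-1)^{s2})`. -/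
noncomputable def ktT (s1 s2 : ℕ) (σ1 σ2 : ℝ) : ℝ :=
  4 * ∑' x : {p : ℕ × ℕ // 0 < p.2 ∧ p.2 < p.1},
    σ1 ^ x.1.1 * σ2 ^ x.1.2 /
      ((2 * (x.1.1 : ℝ) - 2) ^ s1 * (2 * (x.1.2 : ℝ) - 1) ^ s2)

open Polynomial

lemma kt_hs {f g : ℕ → ℝ} {a b : ℝ} (h : HasSum f a) (h1 : ∀ i, g i = f i) (h2 : b = a) :
    HasSum g b := by
  have : g = f := funext h1
  rw [this, h2]; exact h

lemma kt_antideriv (A : Subalgebra ℚ ℝ) (Q : A[X]) : ∃ R : A[X], derivative R = Q := by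
  induction Q using Polynomial.induction_on' with
  | add p q hp hq =>
    obtain ⟨a, rfl⟩ := hp
    obtain ⟨b, rfl⟩ := hq
    exact ⟨a + b, by simp⟩
  | monomial n a =>
    refine ⟨monomial (n+1) (((n+1 : ℚ)⁻¹) • a), ?_⟩
    rw [derivative_monomial]
    congr 1
    apply Subtype.ext
    simp [Algebra.smul_def]
    field_simp

lemma kt_cos_half (i : ℕ) : Real.cos ((2 * (i:ℝ) + 1) * (Real.pi / 2)) = 0 := by
  rw [show (2 * (i:ℝ) + 1) * (Real.pi / 2) = Real.pi / 2 + i * Real.pi by ring,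
    Real.cos_add_nat_mul_pi]
  simp

lemma kt_sin_half (i : ℕ) : Real.sin ((2 * (i:ℝ) + 1) * (Real.pi / 2)) = (-1) ^ i := by
  rw [show (2 * (i:ℝ) + 1) * (Real.pi / 2) = Real.pi / 2 + i * Real.pi by ring,
    Real.sin_add_nat_mul_pi]
  simp

lemma kt_cont (A : Subalgebra ℚ ℝ) (R : A[X]) : Continuous fun x : ℝ => aeval x R := by
  exact continuous_iff_continuousAt.2 fun x => (R.hasDerivAt_aeval x).continuousAt

lemma kt_ibp_sin (A : Subalgebra ℚ ℝ) (R : A[X]) (i : ℕ) :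
    ∫ x in (0:ℝ)..(Real.pi/2), aeval x R * Real.sin ((2 * (i:ℝ) + 1) * x)
      = (aeval (0:ℝ) R + ∫ x in (0:ℝ)..(Real.pi/2),
          aeval x (derivative R) * Real.cos ((2 * (i:ℝ) + 1) * x)) / (2 * (i:ℝ) + 1) := by
  have hj : (2 * (i:ℝ) + 1) ≠ 0 := by positivity
  have hv : ∀ x ∈ Set.uIcc (0:ℝ) (Real.pi/2),
      HasDerivAt (fun x => - Real.cos ((2 * (i:ℝ) + 1) * x) / (2 * (i:ℝ) + 1))
        (Real.sin ((2 * (i:ℝ) + 1) * x)) x := by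
    intro x _
    have h := (((hasDerivAt_id x).const_mul (2 * (i:ℝ) + 1)).cos.neg).div_const (2 * (i:ℝ) + 1)
    refine h.congr_deriv ?_
    simp only [mul_one, id]
    field_simp
  have h := intervalIntegral.integral_mul_deriv_eq_deriv_mul
    (fun x _ => R.hasDerivAt_aeval x) hv
    ((kt_cont A _).intervalIntegrable _ _)
    (Continuous.intervalIntegrable (by fun_prop) _ _)
  rw [h, kt_cos_half]
  have : ∀ x : ℝ, aeval x (derivative R) * (- Real.cos ((2 * (i:ℝ) + 1) * x) / (2 * (i:ℝ) + 1))
    = (-1 / (2 * (i:ℝ) + 1)) * (aeval x (derivative R) * Real.cos ((2 * (i:ℝ) + 1) * x)) := by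
    intro x; ring
  simp only [this, intervalIntegral.integral_const_mul]
  simp
  ring

lemma kt_ibp_cos (A : Subalgebra ℚ ℝ) (R : A[X]) (i : ℕ) :
    ∫ x in (0:ℝ)..(Real.pi/2), aeval x R * Real.cos ((2 * (i:ℝ) + 1) * x)
      = (aeval (Real.pi/2) R * (-1)^i - ∫ x in (0:ℝ)..(Real.pi/2),
          aeval x (derivative R) * Real.sin ((2 * (i:ℝ) + 1) * x)) / (2 * (i:ℝ) + 1) := by
  have hj : (2 * (i:ℝ) + 1) ≠ 0 := by positivity
  have hv : ∀ x ∈ Set.uIcc (0:ℝ) (Real.pi/2),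
      HasDerivAt (fun x => Real.sin ((2 * (i:ℝ) + 1) * x) / (2 * (i:ℝ) + 1))
        (Real.cos ((2 * (i:ℝ) + 1) * x)) x := by
    intro x _
    have h := (((hasDerivAt_id x).const_mul (2 * (i:ℝ) + 1)).sin).div_const (2 * (i:ℝ) + 1)
    refine h.congr_deriv ?_
    simp only [mul_one, id]
    field_simp
  have h := intervalIntegral.integral_mul_deriv_eq_deriv_mul
    (fun x _ => R.hasDerivAt_aeval x) hv
    ((kt_cont A _).intervalIntegrable _ _)
    (Continuous.intervalIntegrable (by fun_prop) _ _)
  rw [h, kt_sin_half]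
  have : ∀ x : ℝ, aeval x (derivative R) * (Real.sin ((2 * (i:ℝ) + 1) * x) / (2 * (i:ℝ) + 1))
    = (1 / (2 * (i:ℝ) + 1)) * (aeval x (derivative R) * Real.sin ((2 * (i:ℝ) + 1) * x)) := by
    intro x; ring
  simp only [this, intervalIntegral.integral_const_mul]
  simp
  ring

lemma kt_pihalf (A : Subalgebra ℚ ℝ) (hπ : Real.pi ∈ A) : Real.pi / 2 ∈ A := by
  have := A.smul_mem hπ (1/2 : ℚ)
  rw [Algebra.smul_def] at this
  convert this using 1
  simp; ring

lemma kt_aeval_mem (A : Subalgebra ℚ ℝ) (R : A[X]) (x : ℝ) (hx : x ∈ A) : aeval x R ∈ A := by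
  have := aeval_algebraMap_apply ℝ (⟨x, hx⟩ : A) R
  have h2 : algebraMap A ℝ (⟨x, hx⟩ : A) = x := rfl
  rw [h2] at this
  rw [this]
  exact Subtype.property _

lemma kt_antideriv_zero (A : Subalgebra ℚ ℝ) (Q : A[X]) (x : ℝ) (hx : x ∈ A) :
    ∃ R : A[X], derivative R = Q ∧ aeval x R = 0 := by
  obtain ⟨R, hR⟩ := kt_antideriv A Q
  refine ⟨R - C ⟨aeval x R, kt_aeval_mem A R x hx⟩, by simp [hR], ?_⟩
  simp only [map_sub, aeval_C]
  exact sub_self _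

lemma kt_Q (A : Subalgebra ℚ ℝ) (hπ : Real.pi ∈ A) (σ : ℝ) (h : σ = 1 ∨ σ = -1) (q : ℕ) :
    (σ * (-1) ^ (q+1) = -1 → ∃ Q : A[X], ∀ i : ℕ,
      ∫ x in (0:ℝ)..(Real.pi/2), aeval x Q * Real.sin ((2 * (i:ℝ) + 1) * x)
        = σ ^ (i+1) / (2 * (i:ℝ) + 1) ^ (q+1)) ∧
    (σ * (-1) ^ (q+1) = 1 → ∃ Q : A[X], ∀ i : ℕ,
      ∫ x in (0:ℝ)..(Real.pi/2), aeval x Q * Real.cos ((2 * (i:ℝ) + 1) * x)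
        = σ ^ (i+1) / (2 * (i:ℝ) + 1) ^ (q+1)) := by
  induction q with
  | zero =>
    constructor
    · intro h'
      have : σ = 1 := by norm_num at h'; linarith
      subst this
      refine ⟨1, fun i => ?_⟩
      rw [kt_ibp_sin]
      simp
    · intro h'
      have : σ = -1 := by norm_num at h'; linarith
      subst this
      refine ⟨-1, fun i => ?_⟩
      rw [kt_ibp_cos]
      simp [pow_succ]
  | succ q ih =>
    constructor
    · intro h'
      obtain ⟨Q, hQ⟩ := ih.2 (by rw [pow_succ] at h'; linarith)
      obtain ⟨R, hR, hR0⟩ := kt_antideriv_zero A Q 0 A.zero_mem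
      refine ⟨R, fun i => ?_⟩
      rw [kt_ibp_sin, hR, hQ, hR0, zero_add, div_div, ← pow_succ]
    · intro h'
      obtain ⟨Q, hQ⟩ := ih.1 (by rw [pow_succ] at h'; linarith)
      obtain ⟨R, hR, hR0⟩ := kt_antideriv_zero A (-Q) _ (kt_pihalf A hπ)
      refine ⟨R, fun i => ?_⟩
      rw [kt_ibp_cos, hR, hR0]
      simp only [map_neg, neg_mul, intervalIntegral.integral_neg, hQ]
      rw [zero_mul, zero_sub, neg_neg, div_div, ← pow_succ]

lemma kt_bern (A : Subalgebra ℚ ℝ) (hπ : Real.pi ∈ A) (b : ℚ[X]) (p : ℕ) (hb : b.natDegree ≤ p)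
    (c : ℚ) (r : ℚ) : ∃ P : A[X], ∀ x : ℝ, aeval x P =
      r * Real.pi ^ p * (b.map (algebraMap ℚ ℝ)).eval (x / Real.pi + c) := by
  set b' : ℚ[X] := b.comp (X + C c) with hb'
  have hd : b'.natDegree < p + 1 := by
    have := natDegree_comp_le (p := b) (q := X + C c)
    rw [natDegree_X_add_C] at this
    rw [← hb'] at this
    omega
  let π' : A := ⟨Real.pi, hπ⟩
  refine ⟨∑ i ∈ Finset.range (p+1), monomial i ((r * b'.coeff i) • π' ^ (p - i)), fun x => ?_⟩
  have h1 : (b.map (algebraMap ℚ ℝ)).eval (x / Real.pi + c)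
      = (b'.map (algebraMap ℚ ℝ)).eval (x / Real.pi) := by
    rw [hb', Polynomial.map_comp, eval_comp]
    simp
  rw [h1, eval_eq_sum_range' (n := p+1)
    (lt_of_le_of_lt natDegree_map_le hd), map_sum, Finset.mul_sum]
  refine Finset.sum_congr rfl fun i hi => ?_
  have hi' : i ≤ p := by simpa [Nat.lt_succ_iff] using hi
  have h2 : algebraMap A ℝ ((r * b'.coeff i) • π' ^ (p - i))
      = (r * b'.coeff i : ℚ) * Real.pi ^ (p - i) := by
    rw [← Rat.smul_def]; rfl
  rw [aeval_monomial, h2, coeff_map]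
  have h3 : Real.pi ^ p = Real.pi ^ (p - i) * Real.pi ^ i := by
    rw [← pow_add]; congr 1; omega
  rw [h3, div_pow]
  have := Real.pi_ne_zero
  simp only [eq_ratCast]
  push_cast
  field_simp

lemma kt_natDegree_bern (n : ℕ) : (Polynomial.bernoulli n).natDegree ≤ n := by
  unfold Polynomial.bernoulli
  refine natDegree_sum_le_of_forall_le _ _ fun i hi => ?_
  exact (natDegree_monomial_le _).trans (by omega)

lemma kt_c (σ : ℝ) (h : σ = 1 ∨ σ = -1) : ∃ c : ℚ, (0 ≤ c ∧ c ≤ 1/2) ∧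
    ∀ (n : ℕ) (x : ℝ), Real.sin (2 * Real.pi * n * (x / Real.pi + c)) = σ ^ n * Real.sin (2 * n * x)
    ∧ Real.cos (2 * Real.pi * n * (x / Real.pi + c)) = σ ^ n * Real.cos (2 * n * x) := by
  have := Real.pi_ne_zero
  rcases h with rfl | rfl
  · refine ⟨0, by norm_num, fun n x => ?_⟩
    have : 2 * Real.pi * n * (x / Real.pi + (0:ℚ)) = 2 * n * x := by push_cast; field_simp; ring
    rw [this]; simp
  · refine ⟨1/2, by norm_num, fun n x => ?_⟩
    have : 2 * Real.pi * n * (x / Real.pi + (1/2:ℚ)) = 2 * n * x + n * Real.pi := by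
      push_cast; field_simp
    rw [this, Real.sin_add_nat_mul_pi, Real.cos_add_nat_mul_pi]; simp

lemma kt_mem_Icc (c : ℚ) (hc : 0 ≤ c ∧ c ≤ 1/2) (x : ℝ) (hx : x ∈ Set.Icc 0 (Real.pi/2)) :
    x / Real.pi + c ∈ Set.Icc (0:ℝ) 1 := by
  have := Real.pi_pos
  have h0 : (0:ℝ) ≤ c := by exact_mod_cast hc.1
  have h1 : (c:ℝ) ≤ 1/2 := by 
    have h : ((c:ℚ):ℝ) ≤ ((1/2:ℚ):ℝ) := by exact_mod_cast hc.2
    push_cast at h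
    exact h
  constructor
  · have := hx.1; positivity
  · have : x / Real.pi ≤ 1/2 := by
      rw [div_le_iff₀ this]; linarith [hx.2]
    linarith

/-- Bernoulli polynomial sums, sine version -/
lemma kt_P_sin (A : Subalgebra ℚ ℝ) (hπ : Real.pi ∈ A) (σ : ℝ) (h : σ = 1 ∨ σ = -1) (k : ℕ)
    (hk : k ≠ 0) : ∃ P : A[X], ∀ x ∈ Set.Icc 0 (Real.pi/2),
      HasSum (fun m : ℕ => σ ^ (m+1) / (2 * (m:ℝ) + 2) ^ (2*k+1) * Real.sin (2 * ((m:ℝ)+1) * x))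
        (aeval x P) := by
  obtain ⟨c, hc, hcs⟩ := kt_c σ h
  obtain ⟨P, hP⟩ := kt_bern A hπ (Polynomial.bernoulli (2*k+1)) (2*k+1) (kt_natDegree_bern _) c
    ((-1) ^ (k+1) / 2 / (2*k+1).factorial)
  refine ⟨P, fun x hx => ?_⟩
  have h1 := (hasSum_one_div_nat_pow_mul_sin hk (kt_mem_Icc c hc x hx)).mul_left
    (1 / 2 ^ (2*k+1))
  rw [← hasSum_nat_add_iff' 1] at h1
  refine kt_hs h1 (fun m => ?_) ?_
  · rw [(hcs _ x).1]
    push_cast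
    rw [show (2 * (m:ℝ) + 2) = 2 * (m + 1) by ring, mul_pow]
    field_simp
  · rw [hP]
    simp
    rw [mul_pow]
    field_simp

lemma kt_P_cos (A : Subalgebra ℚ ℝ) (hπ : Real.pi ∈ A) (σ : ℝ) (h : σ = 1 ∨ σ = -1) (k : ℕ)
    (hk : k ≠ 0) : ∃ P : A[X], ∀ x ∈ Set.Icc 0 (Real.pi/2),
      HasSum (fun m : ℕ => σ ^ (m+1) / (2 * (m:ℝ) + 2) ^ (2*k) * Real.cos (2 * ((m:ℝ)+1) * x))
        (aeval x P) := by
  obtain ⟨c, hc, hcs⟩ := kt_c σ h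
  obtain ⟨P, hP⟩ := kt_bern A hπ (Polynomial.bernoulli (2*k)) (2*k) (kt_natDegree_bern _) c
    ((-1) ^ (k+1) / 2 / (2*k).factorial)
  refine ⟨P, fun x hx => ?_⟩
  have h1 := (hasSum_one_div_nat_pow_mul_cos hk (kt_mem_Icc c hc x hx)).mul_left
    (1 / 2 ^ (2*k))
  rw [← hasSum_nat_add_iff' 1] at h1
  refine kt_hs h1 (fun m => ?_) ?_
  · rw [(hcs _ x).2]
    push_cast
    rw [show (2 * (m:ℝ) + 2) = 2 * (m + 1) by ring, mul_pow]
    field_simp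
  · rw [hP]
    simp [hk]
    rw [mul_pow]
    field_simp

lemma kt_P_one_sub_cos (A : Subalgebra ℚ ℝ) (hπ : Real.pi ∈ A) (σ : ℝ) (h : σ = 1 ∨ σ = -1) (k : ℕ)
    (hk : k ≠ 0) : ∃ P : A[X], ∀ x ∈ Set.Icc 0 (Real.pi/2),
      HasSum (fun m : ℕ => σ ^ (m+1) / (2 * (m:ℝ) + 2) ^ (2*k)
        * (1 - Real.cos (2 * ((m:ℝ)+1) * x))) (aeval x P) := by
  obtain ⟨P, hP⟩ := kt_P_cos A hπ σ h k hk
  refine ⟨C ⟨aeval (0:ℝ) P, kt_aeval_mem A P 0 A.zero_mem⟩ - P, fun x hx => ?_⟩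
  have h0 := hP 0 ⟨le_rfl, by positivity⟩
  have h1 := h0.sub (hP x hx)
  simp only [map_sub, aeval_C]
  refine kt_hs h1 (fun m => ?_) rfl
  rw [mul_zero, Real.cos_zero]
  ring

lemma kt_final (A : Subalgebra ℚ ℝ) (hπ : Real.pi ∈ A)
    (hz : ∀ k : ℕ, 1 ≤ k → ∃ a ∈ A, HasSum (fun i : ℕ => 1 / (2 * (i:ℝ) + 1) ^ (2*k+1)) a)
    (hβ : ∀ k : ℕ, 1 ≤ k → ∃ a ∈ A, HasSum (fun i : ℕ => (-1) ^ i / (2 * (i:ℝ) + 1) ^ (2*k)) a)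
    (n : ℕ) : ∀ R : A[X], R.degree < n → ∀ s : ℕ,
    ((s = 0 → aeval (0:ℝ) R = 0) → ∃ a ∈ A, HasSum (fun i : ℕ =>
      (∫ x in (0:ℝ)..(Real.pi/2), aeval x R * Real.sin ((2 * (i:ℝ) + 1) * x))
        / (2 * (i:ℝ) + 1) ^ (2 * s)) a) ∧
    (∃ a ∈ A, HasSum (fun i : ℕ =>
      (∫ x in (0:ℝ)..(Real.pi/2), aeval x R * Real.cos ((2 * (i:ℝ) + 1) * x))
        / (2 * (i:ℝ) + 1) ^ (2 * s + 1)) a) := by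
  induction n with
  | zero =>
    intro R hR s
    have : R = 0 := by
      by_contra hne
      exact absurd hR (by simp [hne])
    subst this
    refine ⟨fun _ => ⟨0, A.zero_mem, by simp [hasSum_zero]⟩, ⟨0, A.zero_mem, by simp [hasSum_zero]⟩⟩
  | succ n ih =>
    intro R hR s
    have hd : (derivative R).degree < n := by
      by_cases h0 : R = 0
      · subst h0; simp
      · by_cases h1 : derivative R = 0
        · rw [h1]; simp
        · have := degree_derivative_lt h0
          rw [degree_eq_natDegree h1] at this ⊢
          rw [degree_eq_natDegree h0] at hR this
          norm_cast at *
          omega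
    constructor
    · intro hs
      obtain ⟨a, ha, hsum⟩ := (ih _ hd s).2
      have key : ∃ b ∈ A, HasSum (fun i : ℕ => aeval (0:ℝ) R * (1 / (2 * (i:ℝ) + 1) ^ (2*s+1))) b := by
        rcases Nat.eq_zero_or_pos s with h | h
        · rw [hs h]; exact ⟨0, A.zero_mem, by simp [hasSum_zero]⟩
        · obtain ⟨b, hb, hb'⟩ := hz s h
          exact ⟨_, A.mul_mem (kt_aeval_mem A R 0 A.zero_mem) hb, hb'.mul_left _⟩
      obtain ⟨b, hb, hb'⟩ := key
      refine ⟨b + a, A.add_mem hb ha, ?_⟩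
      refine kt_hs (hb'.add hsum) (fun i => ?_) rfl
      have hj : (2 * (i:ℝ) + 1) ≠ 0 := by positivity
      rw [kt_ibp_sin, pow_succ]
      field_simp
    · obtain ⟨a, ha, hsum⟩ := (ih _ hd (s+1)).1 (by simp)
      obtain ⟨b, hb, hb'⟩ := hβ (s+1) (by omega)
      refine ⟨_, A.sub_mem (A.mul_mem (kt_aeval_mem A R _ (kt_pihalf A hπ)) hb) ha, ?_⟩
      refine kt_hs ((hb'.mul_left _).sub hsum) (fun i => ?_) rfl
      have hj : (2 * (i:ℝ) + 1) ≠ 0 := by positivity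
      rw [kt_ibp_cos, show 2 * (s+1) = (2*s+1)+1 by ring, pow_succ _ (2*s+1)]
      field_simp

lemma kt_ker_cos (m : ℕ) (x : ℝ) :
    2 * Real.sin x * ∑ i ∈ Finset.range m, Real.cos ((2 * (i:ℝ) + 1) * x)
      = Real.sin (2 * m * x) := by
  induction m with
  | zero => simp
  | succ m ih =>
    rw [Finset.sum_range_succ, mul_add, ih]
    push_cast
    rw [show 2 * ((m:ℝ) + 1) * x = (2 * m + 1) * x + x by ring,
      show 2 * (m:ℝ) * x = (2 * m + 1) * x - x by ring, Real.sin_add, Real.sin_sub]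
    ring

lemma kt_ker_sin (m : ℕ) (x : ℝ) :
    2 * Real.sin x * ∑ i ∈ Finset.range m, Real.sin ((2 * (i:ℝ) + 1) * x)
      = 1 - Real.cos (2 * m * x) := by
  induction m with
  | zero => simp
  | succ m ih =>
    rw [Finset.sum_range_succ, mul_add, ih]
    push_cast
    rw [show 2 * ((m:ℝ) + 1) * x = (2 * m + 1) * x + x by ring,
      show 2 * (m:ℝ) * x = (2 * m + 1) * x - x by ring, Real.cos_add, Real.cos_sub]
    ring

lemma kt_sin_pos {x : ℝ} (hx : x ∈ Set.Ioc 0 (Real.pi/2)) : 0 < Real.sin x :=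
  Real.sin_pos_of_pos_of_lt_pi hx.1 (by linarith [hx.2, Real.pi_pos])

lemma kt_le_sin {x : ℝ} (hx : x ∈ Set.Ioc 0 (Real.pi/2)) : x ≤ 2 * Real.sin x := by
  have h := Real.mul_le_sin hx.1.le hx.2
  have h2 : (1:ℝ)/2 ≤ 2 / Real.pi := by
    rw [div_le_div_iff₀ (by norm_num) Real.pi_pos]; linarith [Real.pi_le_four]
  nlinarith [hx.1]

lemma kt_int (A : Subalgebra ℚ ℝ) (R : A[X]) (h0 : aeval (0:ℝ) R = 0) :
    IntervalIntegrable (fun x => aeval x R / Real.sin x) MeasureTheory.volume 0 (Real.pi/2) := by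
  have hc0 : R.coeff 0 = 0 := by
    have h := aeval_algebraMap_apply ℝ (0 : A) R
    rw [map_zero, h0] at h
    rw [coeff_zero_eq_eval_zero]
    apply Subtype.ext
    have h3 : (aeval (0:A) R) = eval 0 R := by simp [aeval_def, eval₂_eq_eval_map]
    rw [← h3]
    exact h.symm
  obtain ⟨R1, rfl⟩ := X_dvd_iff.2 hc0
  obtain ⟨K, hK⟩ := (isCompact_Icc (a := (0:ℝ)) (b := Real.pi/2)).exists_bound_of_continuousOn
    (kt_cont A R1).continuousOn
  rw [intervalIntegrable_iff_integrableOn_Ioc_of_le (by positivity)]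
  refine MeasureTheory.Measure.integrableOn_of_bounded (M := 2 * K) (by simp) ?_ ?_
  · exact ((kt_cont A _).measurable.div Real.measurable_sin).aestronglyMeasurable
  · rw [MeasureTheory.ae_restrict_iff' measurableSet_Ioc]
    refine Filter.Eventually.of_forall fun x hx => ?_
    have hs := kt_sin_pos hx
    have hl := kt_le_sin hx
    have hb := hK x ⟨hx.1.le, hx.2⟩
    rw [map_mul, aeval_X, norm_div, norm_mul, Real.norm_of_nonneg hx.1.le,
      Real.norm_of_nonneg hs.le, div_le_iff₀ hs]
    nlinarith [norm_nonneg (aeval x R1), hx.1]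

lemma kt_RL (g : ℝ → ℝ) (hg : IntervalIntegrable g MeasureTheory.volume 0 (Real.pi/2)) :
    Filter.Tendsto (fun m : ℕ => ∫ x in (0:ℝ)..(Real.pi/2), g x * Real.cos (2 * m * x))
      Filter.atTop (nhds 0) := by
  set f : ℝ → ℂ := Set.indicator (Set.Ioc 0 (Real.pi/2)) (fun x => (g x : ℂ)) with hf
  have hfi : MeasureTheory.Integrable f := by
    rw [hf, MeasureTheory.integrable_indicator_iff measurableSet_Ioc]
    exact ((intervalIntegrable_iff_integrableOn_Ioc_of_le (by positivity)).1 hg).ofReal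
  have h1 := Real.tendsto_integral_exp_smul_cocompact f
  have h2 : Filter.Tendsto (fun m : ℕ => (m:ℝ) / Real.pi) Filter.atTop (Filter.cocompact ℝ) :=
    (Filter.Tendsto.atTop_div_const Real.pi_pos tendsto_natCast_atTop_atTop).mono_right
      atTop_le_cocompact
  have h3 := (Complex.continuous_re.tendsto 0).comp (h1.comp h2)
  rw [Complex.zero_re] at h3
  refine h3.congr fun m => ?_
  simp only [Function.comp]
  have hi : MeasureTheory.Integrable
      (fun v : ℝ => Real.fourierChar (-(v * ((m:ℝ) / Real.pi))) • f v) := by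
    have := (Real.fourierIntegral_convergent_iff (f := f) (μ := MeasureTheory.volume) ((m:ℝ)/Real.pi)).2 hfi
    simpa [mul_comm] using this
  have h4 := Complex.reCLM.integral_comp_comm hi
  simp only [Complex.reCLM_apply] at h4
  rw [← h4, intervalIntegral.integral_of_le (by positivity),
    ← MeasureTheory.integral_indicator measurableSet_Ioc]
  congr 1
  ext v
  by_cases hv : v ∈ Set.Ioc 0 (Real.pi/2)
  · simp only [hf, Set.indicator_of_mem hv]
    rw [Circle.smul_def, smul_eq_mul, Real.fourierChar_apply, Complex.re_mul_ofReal,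
      show (2 * Real.pi * (-(v * ((m:ℝ) / Real.pi))) : ℝ) = -(2 * m * v) by
        have := Real.pi_ne_zero
        field_simp, Complex.exp_ofReal_mul_I_re, Real.cos_neg]
    ring
  · simp only [hf, Set.indicator_of_notMem hv]
    simp

lemma kt_final2 (A : Subalgebra ℚ ℝ) (hπ : Real.pi ∈ A)
    (hz : ∀ k : ℕ, 1 ≤ k → ∃ a ∈ A, HasSum (fun i : ℕ => 1 / (2 * (i:ℝ) + 1) ^ (2*k+1)) a)
    (hβ : ∀ k : ℕ, 1 ≤ k → ∃ a ∈ A, HasSum (fun i : ℕ => (-1) ^ i / (2 * (i:ℝ) + 1) ^ (2*k)) a)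
    (R : A[X]) (h0 : aeval (0:ℝ) R = 0) :
    ∫ x in (0:ℝ)..(Real.pi/2), aeval x R / (2 * Real.sin x) ∈ A := by
  obtain ⟨a, ha, hs⟩ := (kt_final A hπ hz hβ (R.natDegree + 1) R
    (by
      refine lt_of_le_of_lt degree_le_natDegree ?_
      exact_mod_cast Nat.lt_succ_self _) 0).1 (fun _ => h0)
  have hint := kt_int A R h0
  have h1 := hs.tendsto_sum_nat
  have h2 := ((kt_RL _ hint).const_sub (∫ x in (0:ℝ)..(Real.pi/2), aeval x R / Real.sin x)).const_mul (1/2)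
  have h3 : ∀ m : ℕ, 1/2 * ((∫ x in (0:ℝ)..(Real.pi/2), aeval x R / Real.sin x) -
      ∫ x in (0:ℝ)..(Real.pi/2), aeval x R / Real.sin x * Real.cos (2 * m * x)) =
      ∑ i ∈ Finset.range m,
      (∫ x in (0:ℝ)..(Real.pi/2), aeval x R * Real.sin ((2 * (i:ℝ) + 1) * x))
        / (2 * (i:ℝ) + 1) ^ (2 * 0) := by
    intro m
    have hR := kt_cont A R
    rw [← intervalIntegral.integral_sub hint (hint.mul_continuousOn (by fun_prop)),
      ← intervalIntegral.integral_const_mul]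
    simp only [mul_zero, pow_zero, div_one]
    rw [← intervalIntegral.integral_finsetSum
      (fun i _ => Continuous.intervalIntegrable (by fun_prop) _ _)]
    rw [intervalIntegral.integral_of_le (by positivity),
      intervalIntegral.integral_of_le (by positivity)]
    refine MeasureTheory.setIntegral_congr_fun measurableSet_Ioc fun x hx => ?_
    have hs := kt_sin_pos hx
    have hk := kt_ker_sin m x

    rw [← Finset.mul_sum]
    have : Real.cos (2 * m * x) = 1 - 2 * Real.sin x * ∑ i ∈ Finset.range m, Real.sin ((2 * (i:ℝ) + 1) * x) := by
      linarith
    rw [this]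
    generalize ∑ i ∈ Finset.range m, Real.sin ((2 * (i:ℝ) + 1) * x) = Y
    field_simp
    ring
  have h4 := tendsto_nhds_unique (h1.congr fun m => (h3 m).symm) h2
  have h5 : ∫ x in (0:ℝ)..(Real.pi/2), aeval x R / (2 * Real.sin x) = a := by
    rw [h4, sub_zero, ← intervalIntegral.integral_const_mul]
    congr 1
    ext x
    rw [mul_comm 2, ← div_div]; ring
  rw [h5]; exact ha

lemma kt_swap (Q : ℝ → ℝ) (hQ : Continuous Q) (k : ℕ → ℝ → ℝ) (hk : ∀ m, Continuous (k m))
    (u : ℕ → ℝ) (hu : ∀ m : ℕ, |u m| ≤ 1 / ((m:ℝ)+1)^2)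
    (h1 : ∀ m x, |k m x| ≤ (m:ℝ) + 1)
    (h2 : ∀ m, ∀ x ∈ Set.Ioc 0 (Real.pi/2), |k m x| * Real.sin x ≤ 1)
    (F : ℝ → ℝ) (hF : ∀ x ∈ Set.Ioc 0 (Real.pi/2), HasSum (fun m => u m * k m x) (F x)) :
    HasSum (fun m => u m * ∫ x in (0:ℝ)..(Real.pi/2), Q x * k m x)
      (∫ x in (0:ℝ)..(Real.pi/2), Q x * F x) := by
  obtain ⟨K, hK⟩ := (isCompact_Icc (a := (0:ℝ)) (b := Real.pi/2)).exists_bound_of_continuousOn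
    hQ.continuousOn
  have hu0 : Set.uIoc 0 (Real.pi/2) = Set.Ioc 0 (Real.pi/2) := Set.uIoc_of_le (by positivity)
  have hsum : Summable fun m : ℕ => ((m:ℝ)+1) ^ (-(3/2) : ℝ) := by
    have := (summable_nat_add_iff 1).2 (Real.summable_nat_rpow (p := -(3/2)).2 (by norm_num))
    simpa using this
  have := intervalIntegral.hasSum_integral_of_dominated_convergence
    (μ := MeasureTheory.volume) (a := 0) (b := Real.pi/2)
    (F := fun m x => u m * (Q x * k m x)) (f := fun x => Q x * F x)
    (fun m x => ((m:ℝ)+1) ^ (-(3/2) : ℝ) * (2 * K * x ^ (-(1/2) : ℝ)))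
    (fun m => by
      have := hk m
      exact Continuous.aestronglyMeasurable (by fun_prop))
    (fun m => Filter.Eventually.of_forall fun x hx => by
      rw [hu0] at hx
      have hx0 := hx.1
      have hb := hK x ⟨hx.1.le, hx.2⟩
      have hm : (0:ℝ) < (m:ℝ) + 1 := by positivity
      set a : ℝ := ((m:ℝ)+1) ^ ((1/2) : ℝ) with ha
      set b : ℝ := x ^ (-(1/2) : ℝ) with hb'
      have ha0 : 0 < a := Real.rpow_pos_of_pos hm _
      have hb0 : 0 < b := Real.rpow_pos_of_pos hx0 _
      have ha2 : a ^ 2 = (m:ℝ) + 1 := by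
        rw [ha, ← Real.rpow_natCast, ← Real.rpow_mul hm.le]; norm_num
      have hb2 : b ^ 2 * x = 1 := by
        rw [hb', ← Real.rpow_natCast, ← Real.rpow_mul hx0.le]; norm_num
        rw [Real.rpow_neg_one]; field_simp
      have hkk : |k m x| ≤ 2 * (a * b) := by
        have hA := h1 m x
        have hB := h2 m x hx
        have hl := kt_le_sin hx
        have hB' : |k m x| * x ≤ 2 := by nlinarith [abs_nonneg (k m x)]
        apply abs_le_of_sq_le_sq' _ (by positivity) |>.2
        have e1 : |k m x| ^ 2 * x ≤ 2 * a ^ 2 := by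
          rw [ha2]; nlinarith [abs_nonneg (k m x)]
        have e2 : |k m x| ^ 2 = |k m x| ^ 2 * x * b ^ 2 := by
          rw [mul_assoc, mul_comm x, hb2, mul_one]
        rw [e2]
        have : |k m x| ^ 2 * x * b ^ 2 ≤ 2 * a ^ 2 * b ^ 2 := by gcongr
        nlinarith [mul_pos (pow_pos ha0 2) (pow_pos hb0 2)]
      have hr : ((m:ℝ)+1) ^ (-(3/2) : ℝ) = 1 / ((m:ℝ)+1)^2 * a := by
        rw [ha, one_div, ← Real.rpow_natCast, ← Real.rpow_neg hm.le, ← Real.rpow_add hm]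
        norm_num
      rw [hr, norm_mul, norm_mul, Real.norm_eq_abs (u m), Real.norm_eq_abs (k m x)]
      calc |u m| * (‖Q x‖ * |k m x|) ≤ (1 / ((m:ℝ)+1)^2) * (K * (2 * (a * b))) := by
            have : 0 ≤ K := (norm_nonneg _).trans hb
            have := hu m
            gcongr
        _ = _ := by ring)
    (Filter.Eventually.of_forall fun x hx => hsum.mul_right _)
    (by
      simp only [tsum_mul_right]
      refine IntervalIntegrable.const_mul (IntervalIntegrable.const_mul ?_ _) _
      exact intervalIntegral.intervalIntegrable_rpow' (by norm_num))
    (Filter.Eventually.of_forall fun x hx => by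
      rw [hu0] at hx
      exact kt_hs ((hF x hx).mul_left (Q x)) (fun m => by ring) rfl)
  refine kt_hs this (fun m => ?_) rfl

  rw [intervalIntegral.integral_const_mul]

lemma kt_u (σ : ℝ) (h : σ = 1 ∨ σ = -1) (p : ℕ) (hp : 2 ≤ p) (m : ℕ) :
    |σ ^ (m+1) / (2 * (m:ℝ) + 2) ^ p| ≤ 1 / ((m:ℝ)+1)^2 := by
  have hs : |σ| = 1 := by rcases h with rfl | rfl <;> simp
  have h0 : (0:ℝ) ≤ m := by positivity
  rw [abs_div, abs_pow, hs, one_pow, abs_of_pos (by positivity : (0:ℝ) < (2 * (m:ℝ) + 2) ^ p)]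
  apply one_div_le_one_div_of_le (by positivity)
  calc ((m:ℝ)+1)^2 ≤ (2 * (m:ℝ) + 2) ^ 2 := by gcongr <;> linarith
    _ ≤ _ := pow_le_pow_right₀ (by linarith) hp

lemma kt_abs_sum (f : ℕ → ℝ) (hf : ∀ i, |f i| ≤ 1) (m : ℕ) :
    |∑ i ∈ Finset.range (m+1), f i| ≤ (m:ℝ) + 1 := by
  refine (Finset.abs_sum_le_sum_abs _ _).trans ?_
  refine (Finset.sum_le_sum fun i _ => hf i).trans ?_
  simp

lemma kt_main (A : Subalgebra ℚ ℝ) (hπ : Real.pi ∈ A)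
    (hz : ∀ k : ℕ, 1 ≤ k → ∃ a ∈ A, HasSum (fun i : ℕ => 1 / (2 * (i:ℝ) + 1) ^ (2*k+1)) a)
    (hβ : ∀ k : ℕ, 1 ≤ k → ∃ a ∈ A, HasSum (fun i : ℕ => (-1) ^ i / (2 * (i:ℝ) + 1) ^ (2*k)) a)
    (p q : ℕ) (hp : 2 ≤ p) (hq : 1 ≤ q) (σ1 σ2 : ℝ)
    (h1 : σ1 = 1 ∨ σ1 = -1) (h2 : σ2 = 1 ∨ σ2 = -1)
    (hpar : (-1 : ℝ) ^ (p + q) = -σ2) :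
    ∃ a ∈ A, HasSum (fun m : ℕ => σ1 ^ (m+1) / (2 * (m:ℝ) + 2) ^ p *
      ∑ i ∈ Finset.range (m+1), σ2 ^ (i+1) / (2 * (i:ℝ) + 1) ^ q) a := by
  obtain ⟨q, rfl⟩ : ∃ r, q = r + 1 := ⟨q - 1, by omega⟩
  have hs2 : σ2 * σ2 = 1 := by rcases h2 with rfl | rfl <;> norm_num
  rcases Nat.even_or_odd p with he | ho
  · obtain ⟨k, rfl⟩ := he.two_dvd
    have hk : k ≠ 0 := by omega
    rw [pow_add, pow_mul, neg_one_sq, one_pow, one_mul] at hpar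
    obtain ⟨Q, hQ⟩ := (kt_Q A hπ σ2 h2 q).1 (by rw [hpar]; linarith)
    obtain ⟨P, hP⟩ := kt_P_one_sub_cos A hπ σ1 h1 k hk
    have hP0 : aeval (0:ℝ) P = 0 := by
      have := hP 0 ⟨le_rfl, by positivity⟩
      simp only [mul_zero, Real.cos_zero, sub_self] at this
      exact this.unique hasSum_zero
    have hsw := kt_swap (fun x => aeval x Q) (kt_cont A Q)
      (fun m x => ∑ i ∈ Finset.range (m+1), Real.sin ((2 * (i:ℝ) + 1) * x))
      (fun m => by fun_prop)
      (fun m => σ1 ^ (m+1) / (2 * (m:ℝ) + 2) ^ (2*k)) (kt_u σ1 h1 _ hp)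
      (fun m x => kt_abs_sum _ (fun i => Real.abs_sin_le_one _) m)
      (fun m x hx => by
        have hs := kt_sin_pos hx
        have := kt_ker_sin (m+1) x
        have e : ∀ y : ℝ, |y| * Real.sin x = |y * Real.sin x| := fun y => by
          rw [abs_mul, abs_of_pos hs]
        rw [e, abs_le]
        constructor <;> nlinarith [Real.neg_one_le_cos (2 * ((m+1 : ℕ):ℝ) * x),
          Real.cos_le_one (2 * ((m+1 : ℕ):ℝ) * x)])
      (fun x => aeval x P / (2 * Real.sin x))
      (fun x hx => by
        have hs := kt_sin_pos hx
        refine kt_hs ((hP x ⟨hx.1.le, hx.2⟩).div_const (2 * Real.sin x)) (fun m => ?_) rfl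
        have := kt_ker_sin (m+1) x
        push_cast at this
        rw [← this]
        generalize ∑ i ∈ Finset.range (m+1), Real.sin ((2 * (i:ℝ) + 1) * x) = Y
        field_simp)
    refine ⟨_, ?_, kt_hs hsw (fun m => ?_) rfl⟩
    · have := kt_final2 A hπ hz hβ (Q * P) (by simp [hP0])
      simpa [mul_div_assoc] using this
    · simp only [Finset.mul_sum]
      rw [intervalIntegral.integral_finsetSum (fun i _ => by
        have := kt_cont A Q
        exact Continuous.intervalIntegrable (by fun_prop) _ _), Finset.mul_sum]
      simp only [hQ]
  · obtain ⟨k, rfl⟩ := ho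
    have hk : k ≠ 0 := by omega
    rw [pow_add, pow_succ _ (2*k), pow_mul, neg_one_sq, one_pow, one_mul, neg_one_mul,
      neg_inj] at hpar
    obtain ⟨Q, hQ⟩ := (kt_Q A hπ σ2 h2 q).2 (by rw [hpar]; linarith)
    obtain ⟨P, hP⟩ := kt_P_sin A hπ σ1 h1 k hk
    have hP0 : aeval (0:ℝ) P = 0 := by
      have := hP 0 ⟨le_rfl, by positivity⟩
      simp only [mul_zero, Real.sin_zero] at this
      exact this.unique hasSum_zero
    have hsw := kt_swap (fun x => aeval x Q) (kt_cont A Q)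
      (fun m x => ∑ i ∈ Finset.range (m+1), Real.cos ((2 * (i:ℝ) + 1) * x))
      (fun m => by fun_prop)
      (fun m => σ1 ^ (m+1) / (2 * (m:ℝ) + 2) ^ (2*k+1)) (kt_u σ1 h1 _ hp)
      (fun m x => kt_abs_sum _ (fun i => Real.abs_cos_le_one _) m)
      (fun m x hx => by
        have hs := kt_sin_pos hx
        have := kt_ker_cos (m+1) x
        have e : ∀ y : ℝ, |y| * Real.sin x = |y * Real.sin x| := fun y => by
          rw [abs_mul, abs_of_pos hs]
        rw [e, abs_le]
        constructor <;> nlinarith [Real.neg_one_le_sin (2 * ((m+1 : ℕ):ℝ) * x),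
          Real.sin_le_one (2 * ((m+1 : ℕ):ℝ) * x)])
      (fun x => aeval x P / (2 * Real.sin x))
      (fun x hx => by
        have hs := kt_sin_pos hx
        refine kt_hs ((hP x ⟨hx.1.le, hx.2⟩).div_const (2 * Real.sin x)) (fun m => ?_) rfl
        have := kt_ker_cos (m+1) x
        push_cast at this
        rw [← this]
        generalize ∑ i ∈ Finset.range (m+1), Real.cos ((2 * (i:ℝ) + 1) * x) = Y
        field_simp)
    refine ⟨_, ?_, kt_hs hsw (fun m => ?_) rfl⟩
    · have := kt_final2 A hπ hz hβ (Q * P) (by simp [hP0])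
      simpa [mul_div_assoc] using this
    · simp only [Finset.mul_sum]
      rw [intervalIntegral.integral_finsetSum (fun i _ => by
        have := kt_cont A Q
        exact Continuous.intervalIntegrable (by fun_prop) _ _), Finset.mul_sum]
      simp only [hQ]

lemma kt_summable_odd (s : ℕ) (hs : 2 ≤ s) : Summable fun i : ℕ => 1 / (2 * (i:ℝ) + 1) ^ s := by
  have := (Real.summable_one_div_nat_pow (p := s).2 (by omega)).comp_injective
    (i := fun i : ℕ => 2 * i + 1) (fun a b h => by simpa using h)
  simpa [Function.comp_def] using this

lemma kt_beta (s : ℕ) (hs : 2 ≤ s) :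
    HasSum (fun i : ℕ => (-1 : ℝ) ^ i / (2 * (i:ℝ) + 1) ^ s) (betaVal s) := by
  refine Summable.hasSum (Summable.of_norm ?_)
  refine (kt_summable_odd s hs).congr fun i => ?_
  rw [norm_div, norm_pow, norm_neg, norm_one, one_pow, Real.norm_of_nonneg (by positivity)]

lemma kt_zeta (s : ℕ) (hs : 2 ≤ s) :
    HasSum (fun i : ℕ => 1 / (2 * (i:ℝ) + 1) ^ s) ((1 - (1/2 : ℚ) ^ s) • zetaVal s) := by
  have hsum : Summable fun n : ℕ => 1 / ((n : ℝ) + 1) ^ s := by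
    have := (summable_nat_add_iff 1).2 (Real.summable_one_div_nat_pow (p := s).2 (by omega))
    simpa using this
  have ho := kt_summable_odd s hs
  have he : HasSum (fun i : ℕ => 1 / (((2 * i + 1 : ℕ) : ℝ) + 1) ^ s) ((1/2)^s * zetaVal s) := by
    refine kt_hs (hsum.hasSum.mul_left ((1/2)^s)) (fun i => ?_) rfl
    push_cast
    rw [show (2 * (i:ℝ) + 1 + 1) = 2 * (i + 1) by ring, mul_pow, div_pow]
    field_simp
    simp
  have h1 : HasSum (fun i : ℕ => 1 / (((2 * i : ℕ) : ℝ) + 1) ^ s)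
      (∑' i : ℕ, 1 / (2 * (i:ℝ) + 1) ^ s) :=
    kt_hs ho.hasSum (fun i => by push_cast; rfl) rfl
  have h2 := (HasSum.even_add_odd (f := fun n : ℕ => 1 / ((n : ℝ) + 1) ^ s) h1 he).unique hsum.hasSum
  refine kt_hs ho.hasSum (fun _ => rfl) ?_
  have h3 : zetaVal s = ∑' n : ℕ, 1 / ((n : ℝ) + 1) ^ s := rfl
  rw [← h3] at h2
  rw [Rat.smul_def]
  push_cast
  linarith

def kt_equiv : (Σ m : ℕ, Fin (m+1)) ≃ {p : ℕ × ℕ // 0 < p.2 ∧ p.2 < p.1} where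
  toFun x := ⟨(x.1 + 2, x.2.1 + 1), by simp, by have := x.2.2; simp; omega⟩
  invFun x := ⟨x.1.1 - 2, ⟨x.1.2 - 1, by have := x.2; omega⟩⟩
  left_inv x := rfl
  right_inv x := by
    rcases x with ⟨⟨a, b⟩, h⟩
    simp only at h
    apply Subtype.ext
    simp only [Prod.mk.injEq]
    omega

lemma kt_summable_p (q : ℕ) (σ1 σ2 : ℝ) (h1 : σ1 = 1 ∨ σ1 = -1) (h2 : σ2 = 1 ∨ σ2 = -1) :
    ¬ Summable (fun x : {p : ℕ × ℕ // 0 < p.2 ∧ p.2 < p.1} => σ1 ^ x.1.1 * σ2 ^ x.1.2 /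
      ((2 * (x.1.1 : ℝ) - 2) ^ 1 * (2 * (x.1.2 : ℝ) - 1) ^ q)) := by
  intro h
  have hs1 : |σ1| = 1 := by rcases h1 with rfl | rfl <;> simp
  have hs2 : |σ2| = 1 := by rcases h2 with rfl | rfl <;> simp
  have h3 := h.abs.comp_injective
    (i := fun m : ℕ => (⟨(m + 2, 1), by simp, by simp⟩ : {p : ℕ × ℕ // 0 < p.2 ∧ p.2 < p.1}))
    (fun a b hab => by simpa using hab)
  have h4 := (h3.mul_left 2)
  refine Real.not_summable_one_div_natCast ((summable_nat_add_iff 1).1 (h4.congr fun m => ?_))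
  simp only [Function.comp]
  push_cast
  have : (2 * ((m:ℝ) + 2) - 2) = 2 * (m + 1) := by ring
  rw [this, abs_div, abs_mul, abs_pow, abs_pow, hs1, hs2, abs_mul, abs_of_pos (by positivity : (0:ℝ) < (2 * ((m:ℝ) + 1))^1)]
  norm_num
  field_simp

theorem stmt7 (p q : ℕ) (hp : 1 ≤ p) (hq : 1 ≤ q) (σ1 σ2 : ℝ)
    (h1 : σ1 = 1 ∨ σ1 = -1) (h2 : σ2 = 1 ∨ σ2 = -1)
    (hne : ¬(p = 1 ∧ σ1 = 1))
    (hpar : (-1 : ℝ) ^ (p + q) = -σ2) :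
    ktT p q σ1 σ2 ∈ Algebra.adjoin ℚ
      ({Real.pi, betaVal 2}
        ∪ {x : ℝ | ∃ k : ℕ, 1 ≤ k ∧ x = zetaVal (2 * k + 1)}
        ∪ {x : ℝ | ∃ k : ℕ, 2 ≤ k ∧ x = betaVal (2 * k)}) := by
  set S : Set ℝ := ({Real.pi, betaVal 2}
        ∪ {x : ℝ | ∃ k : ℕ, 1 ≤ k ∧ x = zetaVal (2 * k + 1)}
        ∪ {x : ℝ | ∃ k : ℕ, 2 ≤ k ∧ x = betaVal (2 * k)}) with hS
  set A := Algebra.adjoin ℚ S with hA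
  have hsub : S ⊆ A := Algebra.subset_adjoin
  have hπ : Real.pi ∈ A := hsub (by simp [hS])
  have hz : ∀ k : ℕ, 1 ≤ k → ∃ a ∈ A, HasSum (fun i : ℕ => 1 / (2 * (i:ℝ) + 1) ^ (2*k+1)) a :=
    fun k hk => ⟨_, A.smul_mem (hsub (Or.inl (Or.inr ⟨k, hk, rfl⟩))) _, kt_zeta _ (by omega)⟩
  have hβ : ∀ k : ℕ, 1 ≤ k → ∃ a ∈ A,
      HasSum (fun i : ℕ => (-1) ^ i / (2 * (i:ℝ) + 1) ^ (2*k)) a := by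
    intro k hk
    refine ⟨_, ?_, kt_beta _ (by omega)⟩
    rcases Nat.lt_or_ge k 2 with h | h
    · have : k = 1 := by omega
      subst this
      exact hsub (by simp [hS])
    · exact hsub (Or.inr ⟨k, h, rfl⟩)
  unfold ktT
  by_cases hsum : Summable (fun x : {p : ℕ × ℕ // 0 < p.2 ∧ p.2 < p.1} => σ1 ^ x.1.1 * σ2 ^ x.1.2 /
      ((2 * (x.1.1 : ℝ) - 2) ^ p * (2 * (x.1.2 : ℝ) - 1) ^ q))
  · have hp2 : 2 ≤ p := by
      by_contra hlt
      have : p = 1 := by omega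
      subst this
      exact kt_summable_p q σ1 σ2 h1 h2 hsum
    obtain ⟨a, ha, hs⟩ := kt_main A hπ hz hβ p q hp2 hq σ1 σ2 h1 h2 hpar
    have hσ : σ1 ∈ A := by
      rcases h1 with rfl | rfl
      · exact A.one_mem
      · exact A.neg_mem A.one_mem
    have key : ∑' x : {p : ℕ × ℕ // 0 < p.2 ∧ p.2 < p.1}, σ1 ^ x.1.1 * σ2 ^ x.1.2 /
      ((2 * (x.1.1 : ℝ) - 2) ^ p * (2 * (x.1.2 : ℝ) - 1) ^ q) = σ1 * a := by
      rw [← kt_equiv.tsum_eq]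
      refine (Summable.tsum_sigma ((kt_equiv.summable_iff).2 hsum)).trans ?_
      rw [← (hs.mul_left σ1).tsum_eq]
      congr 1
      ext m
      rw [tsum_fintype, Finset.mul_sum, Finset.mul_sum, Finset.sum_range]
      refine Finset.sum_congr rfl fun i _ => ?_
      simp only [kt_equiv, Equiv.coe_fn_mk, Function.comp]
      push_cast
      rw [show 2 * ((m:ℝ) + 2) - 2 = 2 * m + 2 by ring,
        show 2 * (((i:ℕ):ℝ) + 1) - 1 = 2 * ((i:ℕ):ℝ) + 1 by ring]
      field_simp
      ring
    rw [key]
    exact A.mul_mem (by exact_mod_cast A.natCast_mem 4) (A.mul_mem hσ ha)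
  · rw [tsum_eq_zero_of_not_summable hsum, mul_zero]
    exact A.zero_mem
end

section
/- For all integers m, p, q ≥ 1 and signs σ1, σ2, σ3 ∈ {1,−1} with (m,σ1) ≠ (1,1), one has t̃(m,p,q; σ1,σ2,σ3) + t̃(m,q,p; σ1,σ3,σ2) + t̃(m, p+q; σ1, σ2σ3) = σ1σ2σ3 · T_{p,q,m}^{σ2,σ3,σ1}. -/
open scoped BigOperators

/-- Double t̃-value `t̃(s1,s2;σ1,σ2) = ∑_{n>k≥1} σ1^n σ2^k /((n-1/2)^{s1} (k-1/2)^{s2})`. -/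
noncomputable def dtt (s1 s2 : ℕ) (σ1 σ2 : ℝ) : ℝ :=
  ∑' x : {y : ℕ × ℕ // 0 < y.2 ∧ y.2 < y.1},
    σ1 ^ x.1.1 * σ2 ^ x.1.2 /
      (((x.1.1 : ℝ) - 1 / 2) ^ s1 * ((x.1.2 : ℝ) - 1 / 2) ^ s2)

/-- Triple t̃-value
`t̃(s1,s2,s3;σ1,σ2,σ3)
  = ∑_{n1>n2>n3≥1} σ1^{n1} σ2^{n2} σ3^{n3}/((n1-1/2)^{s1} (n2-1/2)^{s2} (n3-1/2)^{s3})`. -/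
noncomputable def ttt (s1 s2 s3 : ℕ) (σ1 σ2 σ3 : ℝ) : ℝ :=
  ∑' x : {y : ℕ × ℕ × ℕ // 0 < y.2.2 ∧ y.2.2 < y.2.1 ∧ y.2.1 < y.1},
    σ1 ^ x.1.1 * σ2 ^ x.1.2.1 * σ3 ^ x.1.2.2 /
      (((x.1.1 : ℝ) - 1 / 2) ^ s1 * ((x.1.2.1 : ℝ) - 1 / 2) ^ s2
        * ((x.1.2.2 : ℝ) - 1 / 2) ^ s3)

/-- Quadratic Euler T-sum
`T_{p1,p2,q}^{σ1,σ2,σ} = ∑_{n≥1} σ^{n-1} h_{n-1}^{(p1)}(σ1) h_{n-1}^{(p2)}(σ2)/(n-1/2)^q`. -/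
noncomputable def TSum2 (p1 p2 q : ℕ) (σ1 σ2 σ : ℝ) : ℝ :=
  ∑' n : ℕ, σ ^ n * oddH n p1 σ1 * oddH n p2 σ2 / ((n : ℝ) + 1 / 2) ^ q


lemma aux_not_summable (a : ℝ) (ha : 0 < a) : ¬ Summable (fun n : ℕ => 1 / ((n : ℝ) + a)) := by
  intro h
  have := (Real.summable_one_div_nat_add_rpow a 1).1 (by
    refine h.congr fun n => ?_
    rw [Real.rpow_one, abs_of_pos (by positivity)])
  exact lt_irrefl _ this

lemma aux_abs_pow {σ : ℝ} (h : σ = 1 ∨ σ = -1) (n : ℕ) : |σ ^ n| = 1 := by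
  rcases h with rfl | rfl <;> simp

lemma aux_summable : Summable (fun n : ℕ => ((n : ℝ) + 1 / 2) ^ (-(4 / 3) : ℝ)) := by
  refine ((Real.summable_one_div_nat_add_rpow (1/2) (4/3)).2 (by norm_num)).congr fun n => ?_
  rw [abs_of_pos (by positivity), Real.rpow_neg (by positivity), one_div]

lemma aux_oddH (n p : ℕ) (hp : 1 ≤ p) (σ : ℝ) (h : σ = 1 ∨ σ = -1) :
    1 ≤ oddH (n + 1) p σ := by
  have h2 : (1 : ℝ) + 1 ≤ 1 / (1 / 2) ^ p := by
    rw [one_div_pow, one_div_one_div]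
    calc (1 : ℝ) + 1 = 2 ^ 1 := by norm_num
      _ ≤ 2 ^ p := pow_le_pow_right₀ (by norm_num) hp
  rcases h with rfl | rfl
  · have : ∀ n, 1 ≤ oddH (n + 1) p 1 := by
      intro n
      induction n with
      | zero => simp [oddH] at h2 ⊢; linarith
      | succ k ih =>
        rw [oddH, Finset.sum_range_succ, ← oddH]
        have : (0 : ℝ) ≤ 1 ^ (k + 1) / (((k + 1 : ℕ) : ℝ) + 1 / 2) ^ p := by positivity
        linarith
    exact this n
  · have key : ∀ j : ℕ, 1 ≤ oddH (2 * j + 2) p (-1) := by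
      intro j
      induction j with
      | zero =>
        have : (1 : ℝ) / (1 + 1 / 2) ^ p ≤ 1 := by
          rw [div_le_one (by positivity)]
          exact one_le_pow₀ (by norm_num)
        simp [oddH, Finset.sum_range_succ] at h2 this ⊢
        have e : -1 / (1 + 2⁻¹ : ℝ) ^ p = - ((1 + 2⁻¹ : ℝ) ^ p)⁻¹ := by rw [neg_div, one_div]
        rw [e]
        linarith
      | succ k ih =>
        rw [show 2 * (k + 1) + 2 = (2 * k + 2) + 1 + 1 by ring]
        rw [oddH, Finset.sum_range_succ, Finset.sum_range_succ, ← oddH]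
        have e1 : (-1 : ℝ) ^ (2 * k + 2) = 1 := Even.neg_one_pow ⟨k + 1, by ring⟩
        have e2 : (-1 : ℝ) ^ (2 * k + 2 + 1) = -1 := Odd.neg_one_pow ⟨k + 1, by ring⟩
        rw [e1, e2, neg_div]
        have : (1 : ℝ) / (((2 * k + 2 + 1 : ℕ) : ℝ) + 1 / 2) ^ p
            ≤ 1 / (((2 * k + 2 : ℕ) : ℝ) + 1 / 2) ^ p := by
          apply one_div_le_one_div_of_le (by positivity)
          apply pow_le_pow_left₀ (by positivity)
          push_cast; linarith
        linarith
    rcases Nat.even_or_odd' n with ⟨j, rfl | rfl⟩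
    · rcases j with _ | j
      · simp [oddH] at h2 ⊢; linarith
      · rw [show 2 * (j + 1) + 1 = (2 * j + 2) + 1 by ring]
        rw [oddH, Finset.sum_range_succ, ← oddH]
        have e1 : (-1 : ℝ) ^ (2 * j + 2) = 1 := Even.neg_one_pow ⟨j + 1, by ring⟩
        rw [e1]
        have : (0 : ℝ) ≤ 1 / (((2 * j + 2 : ℕ) : ℝ) + 1 / 2) ^ p := by positivity
        linarith [key j]
    · exact key j

lemma aux_ttt_one (p q : ℕ) (σ1 σ2 σ3 : ℝ)
    (h1 : σ1 = 1 ∨ σ1 = -1) (h2 : σ2 = 1 ∨ σ2 = -1) (h3 : σ3 = 1 ∨ σ3 = -1) :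
    ttt 1 p q σ1 σ2 σ3 = 0 := by
  apply tsum_eq_zero_of_not_summable
  intro h
  let i : ℕ → {y : ℕ × ℕ × ℕ // 0 < y.2.2 ∧ y.2.2 < y.2.1 ∧ y.2.1 < y.1} :=
    fun n => ⟨(n + 3, 2, 1), by simp⟩
  have hi : Function.Injective i := by
    intro a b hab
    simpa [i] using hab
  have h' := (h.comp_injective hi).abs.mul_left ((((2 : ℝ) - 1 / 2) ^ p * ((1 : ℝ) - 1 / 2) ^ q))
  refine aux_not_summable (5 / 2) (by norm_num) (h'.congr fun n => ?_)
  have e : ((n : ℝ) + 3 - 1 / 2) = n + 5 / 2 := by ring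
  simp only [Function.comp, i, abs_div, abs_mul, aux_abs_pow h1, aux_abs_pow h2, aux_abs_pow h3]
  push_cast
  rw [e, abs_of_pos (a := ((n : ℝ) + 5 / 2) ^ 1) (by positivity),
    abs_of_pos (a := ((2 : ℝ) - 1 / 2) ^ p) (by norm_num),
    abs_of_pos (a := ((1 : ℝ) - 1 / 2) ^ q) (by norm_num)]
  have : (0 : ℝ) < (2 - 1 / 2) ^ p := by norm_num
  have : (0 : ℝ) < (1 - 1 / 2) ^ q := by norm_num
  field_simp

lemma aux_dtt_one (p : ℕ) (σ1 σ2 : ℝ)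
    (h1 : σ1 = 1 ∨ σ1 = -1) (h2 : σ2 = 1 ∨ σ2 = -1) :
    dtt 1 p σ1 σ2 = 0 := by
  apply tsum_eq_zero_of_not_summable
  intro h
  let i : ℕ → {y : ℕ × ℕ // 0 < y.2 ∧ y.2 < y.1} :=
    fun n => ⟨(n + 2, 1), by simp⟩
  have hi : Function.Injective i := by
    intro a b hab
    simpa [i] using hab
  have h' := (h.comp_injective hi).abs.mul_left (((1 : ℝ) - 1 / 2) ^ p)
  refine aux_not_summable (3 / 2) (by norm_num) (h'.congr fun n => ?_)
  have e : ((n : ℝ) + 2 - 1 / 2) = n + 3 / 2 := by ring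
  simp only [Function.comp, i, abs_div, abs_mul, aux_abs_pow h1, aux_abs_pow h2]
  push_cast
  rw [e, abs_of_pos (a := ((n : ℝ) + 3 / 2) ^ 1) (by positivity),
    abs_of_pos (a := ((1 : ℝ) - 1 / 2) ^ p) (by norm_num)]
  have : (0 : ℝ) < (1 - 1 / 2) ^ p := by norm_num
  field_simp

lemma aux_T_one (p q : ℕ) (hp : 1 ≤ p) (hq : 1 ≤ q) (σ1 σ2 σ3 : ℝ)
    (h1 : σ1 = 1 ∨ σ1 = -1) (h2 : σ2 = 1 ∨ σ2 = -1) (h3 : σ3 = 1 ∨ σ3 = -1) :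
    TSum2 p q 1 σ2 σ3 σ1 = 0 := by
  apply tsum_eq_zero_of_not_summable
  intro h
  have h' := ((summable_nat_add_iff 1).2 h).abs
  refine aux_not_summable (3 / 2) (by norm_num)
    (Summable.of_nonneg_of_le (fun n => by positivity) (fun n => ?_) h')
  have a := aux_oddH n p hp σ2 h2
  have b := aux_oddH n q hq σ3 h3
  rw [abs_div, abs_mul, abs_mul, aux_abs_pow h1, abs_of_pos (by linarith : 0 < oddH (n+1) p σ2),
    abs_of_pos (by linarith : 0 < oddH (n+1) q σ3), pow_one, abs_of_pos (by positivity)]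
  push_cast
  rw [show ((n : ℝ) + 1 + 1 / 2) = n + 3 / 2 by ring]
  apply div_le_div_of_nonneg_right _ (by positivity)
  nlinarith

/-- The shifted triple summand. -/
noncomputable def auxF (m p q : ℕ) (σ1 σ2 σ3 : ℝ) (x : ℕ × ℕ × ℕ) : ℝ :=
  σ1 ^ (x.1 + 1) * σ2 ^ (x.2.1 + 1) * σ3 ^ (x.2.2 + 1) /
      (((x.1 : ℝ) + 1 / 2) ^ m * ((x.2.1 : ℝ) + 1 / 2) ^ p * ((x.2.2 : ℝ) + 1 / 2) ^ q)


lemma aux_ttt (m p q : ℕ) (σ1 σ2 σ3 : ℝ) :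
    ttt m p q σ1 σ2 σ3 =
      ∑' x, Set.indicator {x : ℕ × ℕ × ℕ | x.2.2 < x.2.1 ∧ x.2.1 < x.1}
        (auxF m p q σ1 σ2 σ3) x := by
  rw [← tsum_subtype]
  let e : {x : ℕ × ℕ × ℕ | x.2.2 < x.2.1 ∧ x.2.1 < x.1} ≃
      {y : ℕ × ℕ × ℕ // 0 < y.2.2 ∧ y.2.2 < y.2.1 ∧ y.2.1 < y.1} :=
    { toFun := fun x => ⟨(x.1.1 + 1, x.1.2.1 + 1, x.1.2.2 + 1), by
        have h := x.2; simp only [Set.mem_ofPred_eq] at h; simp only; omega⟩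
      invFun := fun x => ⟨(x.1.1 - 1, x.1.2.1 - 1, x.1.2.2 - 1), by
        have h := x.2; simp only [Set.mem_ofPred_eq]; omega⟩
      left_inv := by rintro ⟨⟨a, b, c⟩, h⟩; simp
      right_inv := by
        rintro ⟨⟨a, b, c⟩, h⟩
        simp only at h
        simp only [Subtype.mk.injEq, Prod.mk.injEq]; omega }
  rw [ttt, ← e.tsum_eq]
  refine tsum_congr ?_
  rintro ⟨⟨a, b, c⟩, h⟩
  simp only [e, auxF, Equiv.coe_fn_mk]
  push_cast
  ring_nf

lemma aux_ttt' (m p q : ℕ) (σ1 σ2 σ3 : ℝ) :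
    ttt m q p σ1 σ3 σ2 =
      ∑' x, Set.indicator {x : ℕ × ℕ × ℕ | x.2.1 < x.2.2 ∧ x.2.2 < x.1}
        (auxF m p q σ1 σ2 σ3) x := by
  rw [← tsum_subtype]
  let e : {x : ℕ × ℕ × ℕ | x.2.1 < x.2.2 ∧ x.2.2 < x.1} ≃
      {y : ℕ × ℕ × ℕ // 0 < y.2.2 ∧ y.2.2 < y.2.1 ∧ y.2.1 < y.1} :=
    { toFun := fun x => ⟨(x.1.1 + 1, x.1.2.2 + 1, x.1.2.1 + 1), by
        have h := x.2; simp only [Set.mem_ofPred_eq] at h; simp only; omega⟩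
      invFun := fun x => ⟨(x.1.1 - 1, x.1.2.2 - 1, x.1.2.1 - 1), by
        have h := x.2; simp only [Set.mem_ofPred_eq]; omega⟩
      left_inv := by rintro ⟨⟨a, b, c⟩, h⟩; simp
      right_inv := by
        rintro ⟨⟨a, b, c⟩, h⟩
        simp only at h
        simp only [Subtype.mk.injEq, Prod.mk.injEq]; omega }
  rw [ttt, ← e.tsum_eq]
  refine tsum_congr ?_
  rintro ⟨⟨a, b, c⟩, h⟩
  simp only [e, auxF, Equiv.coe_fn_mk]
  push_cast
  ring_nf

lemma aux_dtt (m p q : ℕ) (σ1 σ2 σ3 : ℝ) :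
    dtt m (p + q) σ1 (σ2 * σ3) =
      ∑' x, Set.indicator {x : ℕ × ℕ × ℕ | x.2.1 = x.2.2 ∧ x.2.2 < x.1}
        (auxF m p q σ1 σ2 σ3) x := by
  rw [← tsum_subtype]
  let e : {x : ℕ × ℕ × ℕ | x.2.1 = x.2.2 ∧ x.2.2 < x.1} ≃
      {y : ℕ × ℕ // 0 < y.2 ∧ y.2 < y.1} :=
    { toFun := fun x => ⟨(x.1.1 + 1, x.1.2.2 + 1), by
        have h := x.2; simp only [Set.mem_ofPred_eq] at h; simp only; omega⟩
      invFun := fun x => ⟨(x.1.1 - 1, x.1.2 - 1, x.1.2 - 1), by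
        have h := x.2; simp only [Set.mem_ofPred_eq]; exact ⟨trivial, by omega⟩⟩
      left_inv := by
        rintro ⟨⟨a, b, c⟩, h⟩
        simp only [Set.mem_ofPred_eq] at h
        simp [h.1]
      right_inv := by
        rintro ⟨⟨a, b⟩, h⟩
        simp only at h
        simp only [Subtype.mk.injEq, Prod.mk.injEq]; omega }
  rw [dtt, ← e.tsum_eq]
  refine tsum_congr ?_
  rintro ⟨⟨a, b, c⟩, h⟩
  simp only [Set.mem_ofPred_eq] at h
  obtain ⟨rfl, h⟩ := h
  simp only [e, auxF, Equiv.coe_fn_mk]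
  push_cast
  rw [show ((a : ℝ) + 1 - 1 / 2) = a + 1 / 2 by ring, show ((b : ℝ) + 1 - 1 / 2) = b + 1 / 2 by ring,
    pow_add _ p q, mul_pow, mul_assoc, mul_assoc (_ ^ m)]

lemma aux_rpow (p : ℕ) (hp : 1 ≤ p) (n : ℕ) :
    1 / ((n : ℝ) + 1 / 2) ^ p ≤ 2 ^ p * ((n : ℝ) + 1 / 2)⁻¹ := by
  obtain ⟨r, rfl⟩ : ∃ r, p = r + 1 := ⟨p - 1, by omega⟩
  have hx : (0 : ℝ) < (n : ℝ) + 1 / 2 := by positivity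
  set x := (n : ℝ) + 1 / 2 with hxd
  have h1 : (1 : ℝ) ≤ (2 * x) ^ r := by
    apply one_le_pow₀
    have : (0 : ℝ) ≤ n := Nat.cast_nonneg n
    linarith
  rw [← div_eq_mul_inv, div_le_div_iff₀ (by positivity) hx]
  have : (2 : ℝ) ^ (r + 1) * x ^ (r + 1) = (2 * x) ^ r * (2 * x) := by
    rw [← mul_pow, pow_succ]
  rw [this]
  nlinarith

lemma aux_rpow2 (m : ℕ) (hm : 2 ≤ m) (n : ℕ) :
    1 / ((n : ℝ) + 1 / 2) ^ m ≤ 2 ^ m * (((n : ℝ) + 1 / 2)⁻¹ * ((n : ℝ) + 1 / 2)⁻¹) := by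
  obtain ⟨r, rfl⟩ : ∃ r, m = r + 1 := ⟨m - 1, by omega⟩
  have h := aux_rpow r (by omega) n
  have hx : (0 : ℝ) < (n : ℝ) + 1 / 2 := by positivity
  have hi : (0 : ℝ) < ((n : ℝ) + 1 / 2)⁻¹ := by positivity
  calc 1 / ((n : ℝ) + 1 / 2) ^ (r + 1) = 1 / ((n : ℝ) + 1 / 2) ^ r * ((n : ℝ) + 1 / 2)⁻¹ := by
        rw [pow_succ]; field_simp
    _ ≤ 2 ^ r * ((n : ℝ) + 1 / 2)⁻¹ * ((n : ℝ) + 1 / 2)⁻¹ :=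
        mul_le_mul_of_nonneg_right h hi.le
    _ ≤ 2 ^ (r + 1) * (((n : ℝ) + 1 / 2)⁻¹ * ((n : ℝ) + 1 / 2)⁻¹) := by
        rw [pow_succ]
        have : (0 : ℝ) < 2 ^ r * (((n : ℝ) + 1 / 2)⁻¹ * ((n : ℝ) + 1 / 2)⁻¹) := by positivity
        nlinarith

lemma aux_xyz (x y z : ℝ) (hx : 0 < x) (hy : 0 < y) (hz : 0 < z) (hyx : y ≤ x) (hzx : z ≤ x) :
    x⁻¹ * x⁻¹ * y⁻¹ * z⁻¹ ≤
      x ^ (-(4 / 3) : ℝ) * (y ^ (-(4 / 3) : ℝ) * z ^ (-(4 / 3) : ℝ)) := by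
  have e : ∀ w : ℝ, 0 < w → w ^ (-(4 / 3) : ℝ) = w⁻¹ * w ^ (-(1 / 3) : ℝ) := by
    intro w hw
    rw [← Real.rpow_neg_one w, ← Real.rpow_add hw]; norm_num
  have e2 : x⁻¹ * x⁻¹ = x ^ (-(4 / 3) : ℝ) * (x ^ (-(1 / 3) : ℝ) * x ^ (-(1 / 3) : ℝ)) := by
    rw [← Real.rpow_neg_one x, ← Real.rpow_add hx, ← Real.rpow_add hx, ← Real.rpow_add hx]
    norm_num
  have h1 : x ^ (-(1 / 3) : ℝ) ≤ y ^ (-(1 / 3) : ℝ) :=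
    Real.rpow_le_rpow_of_nonpos hy hyx (by norm_num)
  have h2 : x ^ (-(1 / 3) : ℝ) ≤ z ^ (-(1 / 3) : ℝ) :=
    Real.rpow_le_rpow_of_nonpos hz hzx (by norm_num)
  rw [e2, e y hy, e z hz]
  calc x ^ (-(4 / 3) : ℝ) * (x ^ (-(1 / 3) : ℝ) * x ^ (-(1 / 3) : ℝ)) * y⁻¹ * z⁻¹
      ≤ x ^ (-(4 / 3) : ℝ) * (y ^ (-(1 / 3) : ℝ) * z ^ (-(1 / 3) : ℝ)) * y⁻¹ * z⁻¹ := by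
        gcongr
    _ = _ := by ring

lemma aux_sumF (m p q : ℕ) (hm : 2 ≤ m) (hp : 1 ≤ p) (hq : 1 ≤ q) (σ1 σ2 σ3 : ℝ)
    (h1 : σ1 = 1 ∨ σ1 = -1) (h2 : σ2 = 1 ∨ σ2 = -1) (h3 : σ3 = 1 ∨ σ3 = -1)  :
    Summable (Set.indicator {x : ℕ × ℕ × ℕ | x.2.1 < x.1 ∧ x.2.2 < x.1}
        (auxF m p q σ1 σ2 σ3)) := by
  have hs := aux_summable
  have hpos : ∀ n : ℕ, (0 : ℝ) ≤ ((n : ℝ) + 1 / 2) ^ (-(4 / 3) : ℝ) := fun n => by positivity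
  have hs2 := hs.mul_of_nonneg hs hpos hpos
  have hs3 := (hs.mul_of_nonneg hs2 hpos
    (fun x => mul_nonneg (hpos _) (hpos _))).mul_left ((2 : ℝ) ^ m * 2 ^ p * 2 ^ q)
  refine Summable.of_norm_bounded hs3 ?_
  rintro ⟨a, b, c⟩
  rw [Set.indicator_apply]
  split_ifs with h
  · simp only [Set.mem_ofPred_eq] at h
    have hA := aux_rpow2 m hm a
    have hB := aux_rpow p hp b
    have hC := aux_rpow q hq c
    have hx : (0 : ℝ) < (a : ℝ) + 1 / 2 := by positivity
    have hy : (0 : ℝ) < (b : ℝ) + 1 / 2 := by positivity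
    have hz : (0 : ℝ) < (c : ℝ) + 1 / 2 := by positivity
    have hba : (b : ℝ) ≤ a := by exact_mod_cast h.1.le
    have hca : (c : ℝ) ≤ a := by exact_mod_cast h.2.le
    have key := aux_xyz _ _ _ hx hy hz (by linarith) (by linarith)
    simp only [auxF, Real.norm_eq_abs, abs_div, abs_mul, aux_abs_pow h1, aux_abs_pow h2,
      aux_abs_pow h3]
    rw [abs_of_pos (pow_pos hx m), abs_of_pos (pow_pos hy p), abs_of_pos (pow_pos hz q)]
    set x := (a : ℝ) + 1 / 2
    set y := (b : ℝ) + 1 / 2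
    set z := (c : ℝ) + 1 / 2
    calc 1 * 1 * 1 / (x ^ m * y ^ p * z ^ q) = (1 / x ^ m) * (1 / y ^ p) * (1 / z ^ q) := by
          field_simp
      _ ≤ (2 ^ m * (x⁻¹ * x⁻¹)) * (2 ^ p * y⁻¹) * (2 ^ q * z⁻¹) := by gcongr
      _ = 2 ^ m * 2 ^ p * 2 ^ q * (x⁻¹ * x⁻¹ * y⁻¹ * z⁻¹) := by ring
      _ ≤ _ := mul_le_mul_of_nonneg_left key (by positivity)
  · simp only [norm_zero]
    positivity

lemma aux_T (m p q : ℕ) (σ1 σ2 σ3 : ℝ)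
    (hs : Summable (Set.indicator {x : ℕ × ℕ × ℕ | x.2.1 < x.1 ∧ x.2.2 < x.1}
        (auxF m p q σ1 σ2 σ3))) :
    ∑' x, Set.indicator {x : ℕ × ℕ × ℕ | x.2.1 < x.1 ∧ x.2.2 < x.1} (auxF m p q σ1 σ2 σ3) x
      = σ1 * σ2 * σ3 * TSum2 p q m σ2 σ3 σ1 := by
  rw [hs.tsum_prod, TSum2, ← tsum_mul_left]
  refine tsum_congr fun a => ?_
  rw [tsum_eq_sum (s := Finset.range a ×ˢ Finset.range a)]
  · rw [oddH, oddH, mul_assoc (σ1 ^ a), Finset.sum_mul_sum, ← Finset.sum_product',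
      mul_div_assoc, Finset.sum_div, Finset.mul_sum, Finset.mul_sum]
    refine Finset.sum_congr rfl ?_
    rintro ⟨b, c⟩ h
    simp only [Finset.mem_product, Finset.mem_range] at h
    rw [Set.indicator_of_mem (by simpa using h)]
    simp only [auxF]
    field_simp
    ring
  · rintro ⟨b, c⟩ h
    simp only [Finset.mem_product, Finset.mem_range] at h
    rw [Set.indicator_of_notMem (by simpa using h)]

theorem stmt17 (m p q : ℕ) (hm : 1 ≤ m) (hp : 1 ≤ p) (hq : 1 ≤ q)
    (σ1 σ2 σ3 : ℝ)
    (h1 : σ1 = 1 ∨ σ1 = -1) (h2 : σ2 = 1 ∨ σ2 = -1) (h3 : σ3 = 1 ∨ σ3 = -1)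
    (hne : ¬(m = 1 ∧ σ1 = 1)) :
    ttt m p q σ1 σ2 σ3 + ttt m q p σ1 σ3 σ2 + dtt m (p + q) σ1 (σ2 * σ3) =
      σ1 * σ2 * σ3 * TSum2 p q m σ2 σ3 σ1 := by
  rcases Nat.lt_or_ge m 2 with hm2 | hm2
  · obtain rfl : m = 1 := by omega
    have h23 : σ2 * σ3 = 1 ∨ σ2 * σ3 = -1 := by
      rcases h2 with rfl | rfl <;> rcases h3 with rfl | rfl <;> simp
    rw [aux_ttt_one p q σ1 σ2 σ3 h1 h2 h3, aux_ttt_one q p σ1 σ3 σ2 h1 h3 h2,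
      aux_dtt_one (p + q) σ1 (σ2 * σ3) h1 h23, aux_T_one p q hp hq σ1 σ2 σ3 h1 h2 h3]
    simp
  · have hs := aux_sumF m p q hm2 hp hq σ1 σ2 σ3 h1 h2 h3
    rw [← aux_T m p q σ1 σ2 σ3 hs, aux_ttt m p q, aux_ttt' m p q, aux_dtt m p q]
    have sub : ∀ S : Set (ℕ × ℕ × ℕ), S ⊆ {x : ℕ × ℕ × ℕ | x.2.1 < x.1 ∧ x.2.2 < x.1} →
        Summable (S.indicator (auxF m p q σ1 σ2 σ3)) := by
      intro S hS
      have := hs.indicator S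
      rwa [Set.indicator_indicator, Set.inter_eq_left.2 hS] at this
    have s1 := sub {x : ℕ × ℕ × ℕ | x.2.2 < x.2.1 ∧ x.2.1 < x.1}
      (fun x hx => by simp only [Set.mem_ofPred_eq] at hx ⊢; omega)
    have s2 := sub {x : ℕ × ℕ × ℕ | x.2.1 < x.2.2 ∧ x.2.2 < x.1}
      (fun x hx => by simp only [Set.mem_ofPred_eq] at hx ⊢; omega)
    have s3 := sub {x : ℕ × ℕ × ℕ | x.2.1 = x.2.2 ∧ x.2.2 < x.1}
      (fun x hx => by simp only [Set.mem_ofPred_eq] at hx ⊢; omega)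
    rw [← s1.tsum_add s2, ← (s1.add s2).tsum_add s3]
    refine tsum_congr ?_
    rintro ⟨a, b, c⟩
    simp only [Set.indicator_apply, Set.mem_ofPred_eq]
    split_ifs <;> first | omega | simp
end
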